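/- arXiv:2408.05181 — 5 statements merged into one kernel-verified Lean document; each statement's English description precedes it below -/
import Mathlib

section
/- Let H and A be bialgebras forming a matched pair in the sense of Majid. Then (H,A) is a weak matched pair. -/
open TensorProduct

noncomputable section

namespace WeakSmash

variable (k : Type*) [Field k]

/-- A weak bialgebra structure on the `k`-algebra `H`. -/
structure WeakBialgebra (H : Type*) [Ring H] [Algebra k H] where
  comul : H →ₗ[k] H ⊗[k] H
  counit : H →ₗ[k] k
  coassoc : ∀ h : H,
    (TensorProduct.assoc k H H H) ((LinearMap.rTensor H comul) (comul h)) =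
      (LinearMap.lTensor H comul) (comul h)
  counit_comul : ∀ h : H,
    (TensorProduct.lid k H) ((LinearMap.rTensor H counit) (comul h)) = h
  comul_counit : ∀ h : H,
    (TensorProduct.rid k H) ((LinearMap.lTensor H counit) (comul h)) = h
  comul_mul : ∀ h g : H, comul (h * g) = comul h * comul g
  counit_weak : ∀ h g l : H,
    counit (h * g * l) =
      LinearMap.mul' k k
        ((TensorProduct.map (counit ∘ₗ LinearMap.mulLeft k h)
            (counit ∘ₗ LinearMap.mulRight k l)) (comul g))
  counit_weak' : ∀ h g l : H,
    counit (h * g * l) =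
      LinearMap.mul' k k
        ((TensorProduct.map (counit ∘ₗ LinearMap.mulLeft k h)
            (counit ∘ₗ LinearMap.mulRight k l)) ((TensorProduct.comm k H H) (comul g)))
  comul_one_left :
    ((TensorProduct.assoc k H H H) (comul 1 ⊗ₜ[k] (1 : H))) * ((1 : H) ⊗ₜ[k] comul 1) =
      (LinearMap.lTensor H comul) (comul 1)
  comul_one_right :
    ((1 : H) ⊗ₜ[k] comul 1) * ((TensorProduct.assoc k H H H) (comul 1 ⊗ₜ[k] (1 : H))) =
      (LinearMap.lTensor H comul) (comul 1)

variable {k}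

namespace WeakBialgebra

variable {H : Type*} [Ring H] [Algebra k H]

/-- The target counital map `εt h = ε(1₁ h) 1₂`. -/
def εt (W : WeakBialgebra k H) : H →ₗ[k] H :=
  (TensorProduct.lid k H).toLinearMap ∘ₗ LinearMap.rTensor H W.counit ∘ₗ
    LinearMap.mulLeft k (W.comul 1) ∘ₗ (TensorProduct.mk k H H).flip 1

/-- The source counital map `εs h = 1₁ ε(h 1₂)`. -/
def εs (W : WeakBialgebra k H) : H →ₗ[k] H :=
  (TensorProduct.rid k H).toLinearMap ∘ₗ LinearMap.lTensor H W.counit ∘ₗ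
    LinearMap.mulRight k (W.comul 1) ∘ₗ TensorProduct.mk k H H 1

/-- Cocommutativity of a weak bialgebra. -/
def Cocomm (W : WeakBialgebra k H) : Prop :=
  ∀ h : H, (TensorProduct.comm k H H) (W.comul h) = W.comul h

/-- `S` is an antipode for `W`, making it a weak Hopf algebra. -/
structure IsAntipode (W : WeakBialgebra k H) (S : H →ₗ[k] H) : Prop where
  mul_antipode : ∀ h : H,
    LinearMap.mul' k H ((LinearMap.lTensor H S) (W.comul h)) = W.εt h
  antipode_mul : ∀ h : H,
    LinearMap.mul' k H ((LinearMap.rTensor H S) (W.comul h)) = W.εs h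
  antipode_mid : ∀ h : H,
    LinearMap.mul' k H
      ((TensorProduct.map S (LinearMap.mul' k H ∘ₗ LinearMap.lTensor H S))
        ((LinearMap.lTensor H W.comul) (W.comul h))) = S h

/-- `α` is a left integral: `h α = εt(h) α`. -/
def IsLeftIntegral (W : WeakBialgebra k H) (α : H) : Prop :=
  ∀ h : H, h * α = W.εt h * α

end WeakBialgebra

section MatchedPair

variable (k)
variable {H A : Type*} [Ring H] [Algebra k H] [Ring A] [Algebra k A]

/-- `A` is a left `H`-module algebra via the action `act`. -/
structure IsModuleAlgebra (WH : WeakBialgebra k H) (act : H →ₗ[k] A →ₗ[k] A) : Prop where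
  one_act : ∀ a : A, act 1 a = a
  act_mul : ∀ (h : H) (a b : A),
    act h (a * b) =
      LinearMap.mul' k A ((TensorProduct.map (act.flip a) (act.flip b)) (WH.comul h))
  act_act : ∀ (h g : H) (a : A), act h (act g a) = act (h * g) a
  act_unit : ∀ h : H, act h 1 = act (WH.εt h) 1

/-- The map `h ↦ ε(h⁰) h¹`. -/
def coactCounit (WH : WeakBialgebra k H) (coact : H →ₗ[k] H ⊗[k] A) : H →ₗ[k] A :=
  (TensorProduct.lid k A).toLinearMap ∘ₗ LinearMap.rTensor A WH.counit ∘ₗ coact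

/-- `H` is a right `A`-comodule coalgebra via the coaction `coact`. -/
structure IsComoduleCoalgebra (WH : WeakBialgebra k H) (WA : WeakBialgebra k A)
    (coact : H →ₗ[k] H ⊗[k] A) : Prop where
  counit_coact : ∀ h : H,
    (TensorProduct.rid k H) ((LinearMap.lTensor H WA.counit) (coact h)) = h
  comul_coact : ∀ h : H,
    (LinearMap.rTensor A WH.comul) (coact h) =
      (LinearMap.lTensor (H ⊗[k] H) (LinearMap.mul' k A))
        ((TensorProduct.tensorTensorTensorComm k H A H A)
          ((TensorProduct.map coact coact) (WH.comul h)))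
  coact_coact : ∀ h : H,
    (TensorProduct.assoc k H A A) ((LinearMap.rTensor A coact) (coact h)) =
      (LinearMap.lTensor H WA.comul) (coact h)
  coact_counit : ∀ h : H,
    coactCounit k WH coact h = WA.εs (coactCounit k WH coact h)

/-- The map `(h₁ ⊗ h₂) ⊗ (x₁ ⊗ x₂) ↦ (h₁⁰ · x₁) ⊗ (h₁¹ (h₂ · x₂))`. -/
def pairMapA (act : H →ₗ[k] A →ₗ[k] A) (coact : H →ₗ[k] H ⊗[k] A) :
    (H ⊗[k] H) ⊗[k] (A ⊗[k] A) →ₗ[k] A ⊗[k] A :=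
  LinearMap.lTensor A (LinearMap.mul' k A) ∘ₗ
  (TensorProduct.assoc k A A A).toLinearMap ∘ₗ
  LinearMap.rTensor A
    (LinearMap.rTensor A (TensorProduct.lift act) ∘ₗ
      (TensorProduct.assoc k H A A).symm.toLinearMap ∘ₗ
      LinearMap.lTensor H (TensorProduct.comm k A A).toLinearMap ∘ₗ
      (TensorProduct.assoc k H A A).toLinearMap) ∘ₗ
  TensorProduct.map (LinearMap.rTensor A coact) (TensorProduct.lift act) ∘ₗ
  (TensorProduct.tensorTensorTensorComm k H H A A).toLinearMap

/-- The map `(h₁ ⊗ h₂) ⊗ (g⁰ ⊗ g¹) ↦ (h₁⁰ g⁰) ⊗ (h₁¹ (h₂ · g¹))`. -/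
def pairMapH (act : H →ₗ[k] A →ₗ[k] A) (coact : H →ₗ[k] H ⊗[k] A) :
    (H ⊗[k] H) ⊗[k] (H ⊗[k] A) →ₗ[k] H ⊗[k] A :=
  LinearMap.lTensor H (LinearMap.mul' k A) ∘ₗ
  (TensorProduct.assoc k H A A).toLinearMap ∘ₗ
  LinearMap.rTensor A
    (LinearMap.rTensor A (LinearMap.mul' k H) ∘ₗ
      (TensorProduct.assoc k H H A).symm.toLinearMap ∘ₗ
      LinearMap.lTensor H (TensorProduct.comm k A H).toLinearMap ∘ₗ
      (TensorProduct.assoc k H A H).toLinearMap) ∘ₗ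
  TensorProduct.map (LinearMap.rTensor H coact) (TensorProduct.lift act) ∘ₗ
  (TensorProduct.tensorTensorTensorComm k H H H A).toLinearMap

/-- The iterated comultiplication `h ↦ h₁ ⊗ (h₂ ⊗ h₃)`. -/
def twoComul (WH : WeakBialgebra k H) : H →ₗ[k] H ⊗[k] (H ⊗[k] H) :=
  LinearMap.lTensor H WH.comul ∘ₗ WH.comul

/-- The iterated comultiplication `h ↦ h₁ ⊗ (h₂ ⊗ (h₃ ⊗ h₄))`. -/
def threeComul (WH : WeakBialgebra k H) : H →ₗ[k] H ⊗[k] (H ⊗[k] (H ⊗[k] H)) :=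
  LinearMap.lTensor H (LinearMap.lTensor H WH.comul) ∘ₗ LinearMap.lTensor H WH.comul ∘ₗ WH.comul

/-- Left-hand side of the matched pair condition (iii):
`(h₁·x)₁ ⊗ (h₂ g)⁰ ⊗ (h₁·x)₂ (h₂ g)¹`. -/
def mpLHS (WH : WeakBialgebra k H) (WA : WeakBialgebra k A)
    (act : H →ₗ[k] A →ₗ[k] A) (coact : H →ₗ[k] H ⊗[k] A) (h g : H) (x : A) :
    (A ⊗[k] H) ⊗[k] A :=
  LinearMap.lTensor (A ⊗[k] H) (LinearMap.mul' k A)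
    ((TensorProduct.tensorTensorTensorComm k A A H A)
      ((TensorProduct.map (WA.comul ∘ₗ act.flip x) (coact ∘ₗ LinearMap.mulRight k g))
        (WH.comul h)))

/-- Right-hand side of the matched pair condition (iii):
`(h₁⁰ · x₁) ⊗ (h₃⁰ g⁰) ⊗ (h₁¹ (h₂ · x₂) h₃¹ (h₄ · g¹))`. -/
def mpRHS (WH : WeakBialgebra k H) (WA : WeakBialgebra k A)
    (act : H →ₗ[k] A →ₗ[k] A) (coact : H →ₗ[k] H ⊗[k] A) (h g : H) (x : A) :
    (A ⊗[k] H) ⊗[k] A :=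
  LinearMap.lTensor (A ⊗[k] H) (LinearMap.mul' k A)
    ((TensorProduct.tensorTensorTensorComm k A A H A)
      ((TensorProduct.map
          (pairMapA k act coact ∘ₗ
            (TensorProduct.mk k (H ⊗[k] H) (A ⊗[k] A)).flip (WA.comul x))
          (pairMapH k act coact ∘ₗ
            (TensorProduct.mk k (H ⊗[k] H) (H ⊗[k] A)).flip (coact g)))
        ((TensorProduct.assoc k H H (H ⊗[k] H)).symm (threeComul k WH h))))

/-- `(H, A)` is a weak matched pair. -/
structure IsWeakMatchedPair (WH : WeakBialgebra k H) (WA : WeakBialgebra k A)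
    (act : H →ₗ[k] A →ₗ[k] A) (coact : H →ₗ[k] H ⊗[k] A) : Prop where
  moduleAlgebra : IsModuleAlgebra k WH act
  comoduleCoalgebra : IsComoduleCoalgebra k WH WA coact
  cond3 : ∀ (h g : H) (x : A),
    mpLHS k WH WA act coact h g x = mpRHS k WH WA act coact h g x
  cond4 : ∀ (h : H) (x : A), WA.εs (act h x) = WA.εs (act h 1) * WA.εs x
  cond5 :
    (LinearMap.rTensor H coact) (WH.comul 1) =
      (TensorProduct.map (LinearMap.lTensor H (coactCounit k WH coact))
          (LinearMap.mul' k H))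
        ((TensorProduct.tensorTensorTensorComm k H H H H)
          (WH.comul 1 ⊗ₜ[k] WH.comul 1))

/-- `(H, A)` is a compatible (abelian) weak matched pair. -/
structure IsCompatiblePair (WH : WeakBialgebra k H) (WA : WeakBialgebra k A)
    (act : H →ₗ[k] A →ₗ[k] A) (coact : H →ₗ[k] H ⊗[k] A) : Prop where
  pair : IsWeakMatchedPair k WH WA act coact
  cocomm : WH.Cocomm
  comm : ∀ a b : A, a * b = b * a
  compat1 : ∀ h : H,
    act h 1 =
      (TensorProduct.rid k A)
        ((TensorProduct.map (TensorProduct.lift act)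
            (WA.counit ∘ₗ TensorProduct.lift act))
          ((TensorProduct.tensorTensorTensorComm k H H A A)
            (WH.comul h ⊗ₜ[k] WA.comul 1)))
  compat2 : ∀ h g : H,
    (TensorProduct.map (act h) (act g)) (WA.comul 1) =
      (TensorProduct.map (LinearMap.mulLeft k (act h 1))
        (LinearMap.mulLeft k (act g 1))) (WA.comul 1)

/-- The smash product multiplication on `A ⊗ H`:
`(x ⊗ h) (y ⊗ g) = x (h₁ · y) ⊗ h₂ g`. -/
def smashMul (WH : WeakBialgebra k H) (act : H →ₗ[k] A →ₗ[k] A) :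
    (A ⊗[k] H) ⊗[k] (A ⊗[k] H) →ₗ[k] A ⊗[k] H :=
  LinearMap.rTensor H (LinearMap.mul' k A) ∘ₗ
  (TensorProduct.assoc k A A H).symm.toLinearMap ∘ₗ
  LinearMap.lTensor A
    (TensorProduct.map (TensorProduct.lift act) (LinearMap.mul' k H) ∘ₗ
      (TensorProduct.tensorTensorTensorComm k H H A H).toLinearMap) ∘ₗ
  (TensorProduct.assoc k A (H ⊗[k] H) (A ⊗[k] H)).toLinearMap ∘ₗ
  LinearMap.rTensor (A ⊗[k] H) (LinearMap.lTensor A WH.comul)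

/-- The smash coproduct on `A ⊗ H`:
`Δ(x ⊗ h) = (x₁ ⊗ h₁⁰) ⊗ (x₂ h₁¹ ⊗ h₂)`. -/
def smashComul (WH : WeakBialgebra k H) (WA : WeakBialgebra k A)
    (coact : H →ₗ[k] H ⊗[k] A) :
    A ⊗[k] H →ₗ[k] (A ⊗[k] H) ⊗[k] (A ⊗[k] H) :=
  (TensorProduct.assoc k (A ⊗[k] H) A H).toLinearMap ∘ₗ
  LinearMap.rTensor H (LinearMap.lTensor (A ⊗[k] H) (LinearMap.mul' k A)) ∘ₗ
  LinearMap.rTensor H (TensorProduct.tensorTensorTensorComm k A A H A).toLinearMap ∘ₗ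
  (TensorProduct.assoc k (A ⊗[k] A) (H ⊗[k] A) H).symm.toLinearMap ∘ₗ
  LinearMap.lTensor (A ⊗[k] A) (LinearMap.rTensor H coact) ∘ₗ
  TensorProduct.map WA.comul WH.comul

/-- The smash counit `ε(x ⊗ h) = ε(x) ε(h)`. -/
def smashCounit (WH : WeakBialgebra k H) (WA : WeakBialgebra k A) :
    A ⊗[k] H →ₗ[k] k :=
  LinearMap.mul' k k ∘ₗ TensorProduct.map WA.counit WH.counit

/-- The projection `u ↦ u (1_A # 1_H)` onto `A ♯ H`. -/
def projUnder (WH : WeakBialgebra k H) (act : H →ₗ[k] A →ₗ[k] A) :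
    A ⊗[k] H →ₗ[k] A ⊗[k] H :=
  smashMul k WH act ∘ₗ
    (TensorProduct.mk k (A ⊗[k] H) (A ⊗[k] H)).flip ((1 : A) ⊗ₜ[k] (1 : H))

/-- The projection `u ↦ (id ⊗ ε) Δ(u)` onto `overline(A # H)`. -/
def projBar (WH : WeakBialgebra k H) (WA : WeakBialgebra k A)
    (coact : H →ₗ[k] H ⊗[k] A) : A ⊗[k] H →ₗ[k] A ⊗[k] H :=
  (TensorProduct.rid k (A ⊗[k] H)).toLinearMap ∘ₗ
    LinearMap.lTensor (A ⊗[k] H) (smashCounit k WH WA) ∘ₗ smashComul k WH WA coact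

/-- The projection onto `A ♯♯ H`, i.e. `u ↦ (id ⊗ ε) Δ (u (1#1))`. -/
def projBoth (WH : WeakBialgebra k H) (WA : WeakBialgebra k A)
    (act : H →ₗ[k] A →ₗ[k] A) (coact : H →ₗ[k] H ⊗[k] A) :
    A ⊗[k] H →ₗ[k] A ⊗[k] H :=
  projBar k WH WA coact ∘ₗ projUnder k WH act

/-- Componentwise smash multiplication on `(A⊗H) ⊗ (A⊗H)`. -/
def smashMul2 (WH : WeakBialgebra k H) (act : H →ₗ[k] A →ₗ[k] A) :
    ((A ⊗[k] H) ⊗[k] (A ⊗[k] H)) ⊗[k] ((A ⊗[k] H) ⊗[k] (A ⊗[k] H)) →ₗ[k]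
      (A ⊗[k] H) ⊗[k] (A ⊗[k] H) :=
  TensorProduct.map (smashMul k WH act) (smashMul k WH act) ∘ₗ
    (TensorProduct.tensorTensorTensorComm k (A ⊗[k] H) (A ⊗[k] H)
      (A ⊗[k] H) (A ⊗[k] H)).toLinearMap

/-- Componentwise smash multiplication on threefold tensors. -/
def smashMul3 (WH : WeakBialgebra k H) (act : H →ₗ[k] A →ₗ[k] A) :
    ((A ⊗[k] H) ⊗[k] ((A ⊗[k] H) ⊗[k] (A ⊗[k] H))) ⊗[k]
      ((A ⊗[k] H) ⊗[k] ((A ⊗[k] H) ⊗[k] (A ⊗[k] H))) →ₗ[k]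
      (A ⊗[k] H) ⊗[k] ((A ⊗[k] H) ⊗[k] (A ⊗[k] H)) :=
  TensorProduct.map (smashMul k WH act) (smashMul2 k WH act) ∘ₗ
    (TensorProduct.tensorTensorTensorComm k (A ⊗[k] H)
      ((A ⊗[k] H) ⊗[k] (A ⊗[k] H)) (A ⊗[k] H)
      ((A ⊗[k] H) ⊗[k] (A ⊗[k] H))).toLinearMap

/-- The unit element `1_A ♯♯ 1_H` of `A ♯♯ H`. -/
def smashOne (WH : WeakBialgebra k H) (WA : WeakBialgebra k A)
    (act : H →ₗ[k] A →ₗ[k] A) (coact : H →ₗ[k] H ⊗[k] A) : A ⊗[k] H :=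
  projBoth k WH WA act coact ((1 : A) ⊗ₜ[k] (1 : H))

/-- The map `εt` of the weak bialgebra `A ♯♯ H`: `u ↦ ε(e₁ u) e₂` where `e = 1_A ♯♯ 1_H`. -/
def smashEpsT (WH : WeakBialgebra k H) (WA : WeakBialgebra k A)
    (act : H →ₗ[k] A →ₗ[k] A) (coact : H →ₗ[k] H ⊗[k] A) (u : A ⊗[k] H) :
    A ⊗[k] H :=
  (TensorProduct.lid k (A ⊗[k] H))
    ((LinearMap.rTensor (A ⊗[k] H)
        (smashCounit k WH WA ∘ₗ smashMul k WH act ∘ₗ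
          (TensorProduct.mk k (A ⊗[k] H) (A ⊗[k] H)).flip u))
      (smashComul k WH WA coact (smashOne k WH WA act coact)))

/-- The map `εs` of the weak bialgebra `A ♯♯ H`: `u ↦ e₁ ε(u e₂)` where `e = 1_A ♯♯ 1_H`. -/
def smashEpsS (WH : WeakBialgebra k H) (WA : WeakBialgebra k A)
    (act : H →ₗ[k] A →ₗ[k] A) (coact : H →ₗ[k] H ⊗[k] A) (u : A ⊗[k] H) :
    A ⊗[k] H :=
  (TensorProduct.rid k (A ⊗[k] H))
    ((LinearMap.lTensor (A ⊗[k] H)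
        (smashCounit k WH WA ∘ₗ smashMul k WH act ∘ₗ
          TensorProduct.mk k (A ⊗[k] H) (A ⊗[k] H) u))
      (smashComul k WH WA coact (smashOne k WH WA act coact)))

/-- The antipode of `A ♯♯ H`:
`S(x ⊗ h) = (1_A ♯♯ S_H(h⁰)) ((S_A(x h¹)) ♯♯ 1_H)`. -/
def smashAntipode (WH : WeakBialgebra k H) (WA : WeakBialgebra k A)
    (act : H →ₗ[k] A →ₗ[k] A) (coact : H →ₗ[k] H ⊗[k] A)
    (SH : H →ₗ[k] H) (SA : A →ₗ[k] A) : A ⊗[k] H →ₗ[k] A ⊗[k] H :=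
  smashMul k WH act ∘ₗ
  TensorProduct.map
    (projBoth k WH WA act coact ∘ₗ TensorProduct.mk k A H 1)
    (projBoth k WH WA act coact ∘ₗ (TensorProduct.mk k A H).flip 1) ∘ₗ
  (TensorProduct.comm k A H).toLinearMap ∘ₗ
  TensorProduct.map (SA ∘ₗ LinearMap.mul' k A) SH ∘ₗ
  (TensorProduct.assoc k A A H).symm.toLinearMap ∘ₗ
  LinearMap.lTensor A ((TensorProduct.comm k H A).toLinearMap ∘ₗ coact)

/-- LHS of condition (7): `(1_{H1} h⁰ · 1_A) ⊗ S_A(h¹) εs(1_{H2}¹) ⊗ 1_{H2}⁰`. -/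
def cond7LHS (WH : WeakBialgebra k H) (WA : WeakBialgebra k A)
    (act : H →ₗ[k] A →ₗ[k] A) (coact : H →ₗ[k] H ⊗[k] A)
    (SA : A →ₗ[k] A) (h : H) : (A ⊗[k] A) ⊗[k] H :=
  (TensorProduct.assoc k A A H).symm
    ((TensorProduct.map
        (act.flip 1 ∘ₗ LinearMap.mul' k H)
        ((TensorProduct.comm k H A).toLinearMap ∘ₗ
          LinearMap.lTensor H
            (LinearMap.mul' k A ∘ₗ TensorProduct.map SA WA.εs ∘ₗ
              (TensorProduct.comm k A A).toLinearMap) ∘ₗ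
          (TensorProduct.assoc k H A A).toLinearMap ∘ₗ
          LinearMap.rTensor A coact))
      ((TensorProduct.tensorTensorTensorComm k H H H A)
        (WH.comul 1 ⊗ₜ[k] coact h)))

/-- RHS of condition (7):
`εt(1_{H1}⁰ h⁰ · 1_A) ⊗ εt(h¹) εs(1_{H2}¹) 1_{H1}¹ ⊗ 1_{H2}⁰`. -/
def cond7RHS (WH : WeakBialgebra k H) (WA : WeakBialgebra k A)
    (act : H →ₗ[k] A →ₗ[k] A) (coact : H →ₗ[k] H ⊗[k] A) (h : H) :
    (A ⊗[k] A) ⊗[k] H :=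
  (TensorProduct.assoc k A A H).symm
   ((LinearMap.lTensor A (TensorProduct.comm k H A).toLinearMap)
    ((TensorProduct.assoc k A H A)
     ((LinearMap.lTensor (A ⊗[k] H)
        (LinearMap.mul' k A ∘ₗ (TensorProduct.comm k A A).toLinearMap))
      ((TensorProduct.tensorTensorTensorComm k A A H A)
       ((LinearMap.lTensor (A ⊗[k] A) (TensorProduct.comm k A H).toLinearMap)
        ((TensorProduct.map
            (LinearMap.rTensor A (WA.εt ∘ₗ act.flip 1 ∘ₗ LinearMap.mul' k H) ∘ₗ
              (TensorProduct.assoc k H H A).symm.toLinearMap ∘ₗ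
              LinearMap.lTensor H (TensorProduct.comm k A H).toLinearMap ∘ₗ
              (TensorProduct.assoc k H A H).toLinearMap)
            (LinearMap.rTensor H
                (LinearMap.mul' k A ∘ₗ (TensorProduct.comm k A A).toLinearMap ∘ₗ
                  TensorProduct.map WA.εs WA.εt) ∘ₗ
              (TensorProduct.assoc k A A H).symm.toLinearMap ∘ₗ
              LinearMap.lTensor A (TensorProduct.comm k H A).toLinearMap ∘ₗ
              (TensorProduct.assoc k A H A).toLinearMap ∘ₗ
              LinearMap.rTensor A (TensorProduct.comm k H A).toLinearMap))
          ((TensorProduct.tensorTensorTensorComm k (H ⊗[k] A) (H ⊗[k] A) H A)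
            (((TensorProduct.map coact coact) (WH.comul 1)) ⊗ₜ[k] coact h))))))))

/-- LHS of condition (8):
`εs(h₁¹ h₂¹) (S_H(h₁⁰) · 1_A) ⊗ S_H(h₂⁰) h₃`. -/
def cond8LHS (WH : WeakBialgebra k H) (WA : WeakBialgebra k A)
    (act : H →ₗ[k] A →ₗ[k] A) (coact : H →ₗ[k] H ⊗[k] A)
    (SH : H →ₗ[k] H) (h : H) : A ⊗[k] H :=
  LinearMap.rTensor H (LinearMap.mul' k A)
   ((TensorProduct.assoc k A A H).symm
    ((TensorProduct.map
        (WA.εs ∘ₗ LinearMap.mul' k A)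
        (TensorProduct.map (act.flip 1 ∘ₗ SH)
          (LinearMap.mul' k H ∘ₗ LinearMap.rTensor H SH)))
      ((TensorProduct.tensorTensorTensorComm k A H A (H ⊗[k] H))
        ((TensorProduct.map (TensorProduct.comm k H A).toLinearMap
            ((TensorProduct.assoc k A H H).toLinearMap ∘ₗ
              LinearMap.rTensor H (TensorProduct.comm k H A).toLinearMap))
          ((TensorProduct.map coact (LinearMap.rTensor H coact))
            (twoComul k WH h))))))

/-- RHS of condition (8):
`εs(h¹ 1_{H2}¹) εs(h⁰ 1_{H1} · 1_A) ⊗ 1_{H2}⁰`. -/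
def cond8RHS (WH : WeakBialgebra k H) (WA : WeakBialgebra k A)
    (act : H →ₗ[k] A →ₗ[k] A) (coact : H →ₗ[k] H ⊗[k] A) (h : H) :
    A ⊗[k] H :=
  LinearMap.rTensor H (LinearMap.mul' k A ∘ₗ (TensorProduct.comm k A A).toLinearMap)
   ((TensorProduct.assoc k A A H).symm
    ((TensorProduct.map
        (WA.εs ∘ₗ act.flip 1 ∘ₗ LinearMap.mul' k H)
        (LinearMap.rTensor H (WA.εs ∘ₗ LinearMap.mul' k A) ∘ₗ
          (TensorProduct.assoc k A A H).symm.toLinearMap ∘ₗ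
          LinearMap.lTensor A (TensorProduct.comm k H A).toLinearMap))
      ((TensorProduct.tensorTensorTensorComm k H A H (H ⊗[k] A))
        (coact h ⊗ₜ[k] (LinearMap.lTensor H coact) (WH.comul 1)))))

/-- The element `εs(t₁¹ (t₂ · 1_A)) ⊗ t₁⁰` of `A ⊗ H`. -/
def integralWitness (WH : WeakBialgebra k H) (WA : WeakBialgebra k A)
    (act : H →ₗ[k] A →ₗ[k] A) (coact : H →ₗ[k] H ⊗[k] A) (t : H) :
    A ⊗[k] H :=
  (TensorProduct.comm k H A)
    ((LinearMap.lTensor H (WA.εs ∘ₗ LinearMap.mul' k A))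
      ((TensorProduct.assoc k H A A)
        ((LinearMap.rTensor A coact)
          ((LinearMap.lTensor H (act.flip 1)) (WH.comul t)))))

end MatchedPair

end WeakSmash


namespace WeakSmash

namespace WeakBialgebra

variable {k H : Type*} [Field k] [Ring H] [Algebra k H]

theorem counit_one_smul (W : WeakBialgebra k H) (h1 : W.comul 1 = (1 : H) ⊗ₜ[k] (1 : H))
    (h : H) : W.counit 1 • h = h := by
  have e := W.counit_comul 1
  rw [h1] at e
  simp only [LinearMap.rTensor_tmul, TensorProduct.lid_tmul] at e
  rw [← one_mul h, ← smul_mul_assoc, e]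

theorem εt_eq (W : WeakBialgebra k H) (h1 : W.comul 1 = (1 : H) ⊗ₜ[k] (1 : H)) (h : H) :
    W.εt h = W.counit h • (1 : H) := by
  simp [εt, h1]

theorem εs_eq (W : WeakBialgebra k H) (h1 : W.comul 1 = (1 : H) ⊗ₜ[k] (1 : H)) (h : H) :
    W.εs h = W.counit h • (1 : H) := by
  simp [εs, h1]

theorem map_comul_comul (W : WeakBialgebra k H) (h : H) :
    TensorProduct.map W.comul W.comul (W.comul h) =
      (TensorProduct.assoc k H H (H ⊗[k] H)).symm (threeComul k W h) := by
  have key (t : (H ⊗[k] H) ⊗[k] H) :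
      LinearMap.lTensor H (LinearMap.lTensor H W.comul) (TensorProduct.assoc k H H H t) =
        TensorProduct.assoc k H H (H ⊗[k] H) (LinearMap.lTensor (H ⊗[k] H) W.comul t) := by
    induction t with
    | zero => simp
    | add x y hx hy => simp only [map_add, hx, hy]
    | tmul x y =>
      induction x with
      | zero => simp
      | add x z hx hz => simp only [TensorProduct.add_tmul, map_add, hx, hz]
      | tmul x z => simp
  rw [LinearEquiv.eq_symm_apply, threeComul, LinearMap.comp_apply, LinearMap.comp_apply,
    ← W.coassoc, key, ← LinearMap.comp_apply (LinearMap.lTensor _ _),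
    LinearMap.lTensor_comp_rTensor]

end WeakBialgebra

section

variable {k H A : Type*} [Field k] [Ring H] [Algebra k H] [Ring A] [Algebra k A]

theorem pairMapA_tmul_one (WH : WeakBialgebra k H) (act : H →ₗ[k] A →ₗ[k] A)
    (coact : H →ₗ[k] H ⊗[k] A) (hact : ∀ h : H, act h 1 = WH.counit h • (1 : A))
    (t : H ⊗[k] H) :
    pairMapA k act coact (t ⊗ₜ[k] ((1 : A) ⊗ₜ[k] (1 : A))) =
      (1 : A) ⊗ₜ[k] coactCounit k WH coact
        (TensorProduct.rid k H (LinearMap.lTensor H WH.counit t)) := by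
  induction t with
  | zero => simp
  | add x y hx hy => simp only [TensorProduct.add_tmul, TensorProduct.tmul_add, map_add, hx, hy]
  | tmul x y =>
    simp only [pairMapA, coactCounit, LinearMap.comp_apply, LinearEquiv.coe_coe,
      TensorProduct.tensorTensorTensorComm_tmul, TensorProduct.map_tmul,
      LinearMap.rTensor_tmul, LinearMap.lTensor_tmul, TensorProduct.rid_tmul, map_smul,
      TensorProduct.lift.tmul, hact]
    generalize coact x = u
    induction u with
    | zero => simp
    | add a b ha hb =>
      simp only [TensorProduct.add_tmul, TensorProduct.tmul_add, map_add, smul_add, ha, hb]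
    | tmul a b => simp [hact, TensorProduct.smul_tmul', TensorProduct.tmul_smul]

/-- In a matched pair of bialgebras, `ε(h⁰) h¹ = ε(h) 1`: compare both sides of the formula for
`Δ(h ⊳ 1)`. -/
theorem coactCounit_eq_counit_smul_one (WH : WeakBialgebra k H) (WA : WeakBialgebra k A)
    (hA1 : WA.comul 1 = (1 : A) ⊗ₜ[k] (1 : A))
    (act : H →ₗ[k] A →ₗ[k] A) (coact : H →ₗ[k] H ⊗[k] A)
    (hact : ∀ h : H, act h 1 = WH.counit h • (1 : A))
    (hcomul : ∀ (h : H) (x : A),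
      WA.comul (act h x) = pairMapA k act coact (WH.comul h ⊗ₜ[k] WA.comul x)) (h : H) :
    coactCounit k WH coact h = WH.counit h • (1 : A) := by
  have e := hcomul h 1
  rw [hA1, pairMapA_tmul_one WH act coact hact, WH.comul_counit, hact, map_smul, hA1] at e
  have e' := congrArg (fun t => TensorProduct.lid k A (LinearMap.rTensor A WA.counit t)) e
  simpa [WA.counit_one_smul hA1] using e'.symm

end

theorem matchedPair_isWeakMatchedPair
    {k H A : Type*} [Field k] [Ring H] [Algebra k H] [Ring A] [Algebra k A]
    (WH : WeakBialgebra k H) (WA : WeakBialgebra k A)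
    (hH1 : WH.comul 1 = (1 : H) ⊗ₜ[k] (1 : H))
    (hHeps : ∀ h g : H, WH.counit (h * g) = WH.counit h * WH.counit g)
    (hA1 : WA.comul 1 = (1 : A) ⊗ₜ[k] (1 : A))
    (hAeps : ∀ a b : A, WA.counit (a * b) = WA.counit a * WA.counit b)
    (act : H →ₗ[k] A →ₗ[k] A) (coact : H →ₗ[k] H ⊗[k] A)
    (m1 : ∀ a : A, act 1 a = a)
    (m2 : ∀ (h : H) (a b : A),
      act h (a * b) =
        LinearMap.mul' k A ((TensorProduct.map (act.flip a) (act.flip b)) (WH.comul h)))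
    (m3 : ∀ (h g : H) (a : A), act h (act g a) = act (h * g) a)
    (m4 : ∀ h : H, act h 1 = WH.counit h • (1 : A))
    (c1 : ∀ h : H,
      (TensorProduct.rid k H) ((LinearMap.lTensor H WA.counit) (coact h)) = h)
    (c2 : ∀ h : H,
      (LinearMap.rTensor A WH.comul) (coact h) =
        (LinearMap.lTensor (H ⊗[k] H) (LinearMap.mul' k A))
          ((TensorProduct.tensorTensorTensorComm k H A H A)
            ((TensorProduct.map coact coact) (WH.comul h))))
    (c3 : ∀ h : H,
      (TensorProduct.assoc k H A A) ((LinearMap.rTensor A coact) (coact h)) =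
        (LinearMap.lTensor H WA.comul) (coact h))
    (maj3 : ∀ h g : H,
      coact (h * g) = pairMapH k act coact (WH.comul h ⊗ₜ[k] coact g))
    (maj4 : ∀ (h : H) (x : A),
      WA.comul (act h x) = pairMapA k act coact (WH.comul h ⊗ₜ[k] WA.comul x))
    (maj5 : ∀ (h : H) (x : A), WA.counit (act h x) = WH.counit h * WA.counit x)
    (maj6 : coact 1 = (1 : H) ⊗ₜ[k] (1 : A)) :
    IsWeakMatchedPair k WH WA act coact := by
  have hf := coactCounit_eq_counit_smul_one WH WA hA1 act coact m4 maj4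
  refine ⟨⟨m1, m2, m3, fun h => ?_⟩, ⟨c1, c2, c3, fun h => ?_⟩, fun h g x => ?_, fun h x => ?_, ?_⟩
  · rw [WH.εt_eq hH1, map_smul, LinearMap.smul_apply, m1, m4]
  · rw [WA.εs_eq hA1, hf, map_smul, smul_eq_mul, mul_smul, WA.counit_one_smul hA1]
  · have hA : WA.comul ∘ₗ act.flip x =
        (pairMapA k act coact ∘ₗ
          (TensorProduct.mk k (H ⊗[k] H) (A ⊗[k] A)).flip (WA.comul x)) ∘ₗ WH.comul := by
      ext a
      simp [maj4]
    have hH : coact ∘ₗ LinearMap.mulRight k g =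
        (pairMapH k act coact ∘ₗ
          (TensorProduct.mk k (H ⊗[k] H) (H ⊗[k] A)).flip (coact g)) ∘ₗ WH.comul := by
      ext a
      simp [maj3]
    rw [mpLHS, mpRHS, hA, hH, TensorProduct.map_comp, LinearMap.comp_apply,
      WH.map_comul_comul]
  · simp only [WA.εs_eq hA1, maj5, smul_mul_assoc, one_mul]
    rw [mul_smul, mul_smul, WA.counit_one_smul hA1]
  · have hone : coactCounit k WH coact 1 = 1 := by
      rw [hf, ← m4, m1]
    simp [hH1, maj6, hone]

end WeakSmash
end
end

section
/- Let H be a weak bialgebra and A a commutative weak bialgebra that is a left H-module algebra satisfying εs(h·x) = εs(h·1_A)εs(x) for all h ∈ H and x ∈ A. Then εt(h·x) = εt(h·1_A)εt(x) for all h ∈ H and x ∈ A. -/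
open TensorProduct

noncomputable section

namespace WeakSmash

namespace WeakBialgebra

variable {k : Type*} [Field k] {A : Type*} [Ring A] [Algebra k A]

/-- The functional `g ↦ ε(g y)`. -/
def counitMulRight (W : WeakBialgebra k A) (y : A) : A →ₗ[k] k :=
  W.counit ∘ₗ LinearMap.mulRight k y

/-- The contraction `a ⊗ b ↦ ε(a y) b`. -/
def contractLeft (W : WeakBialgebra k A) (y : A) : A ⊗[k] A →ₗ[k] A :=
  (TensorProduct.lid k A).toLinearMap ∘ₗ LinearMap.rTensor A (W.counitMulRight y)

@[simp]
theorem contractLeft_tmul (W : WeakBialgebra k A) (y a b : A) :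
    W.contractLeft y (a ⊗ₜ[k] b) = W.counit (a * y) • b := by
  simp [contractLeft, counitMulRight]

theorem εt_eq_contractLeft (W : WeakBialgebra k A) (y : A) :
    W.εt y = W.contractLeft y (W.comul 1) := by
  simp only [εt, LinearMap.comp_apply, LinearMap.mulLeft_apply, LinearMap.flip_apply,
    TensorProduct.mk_apply]
  induction W.comul 1 with
  | zero => simp
  | add u v hu hv => simp only [add_mul, map_add, hu, hv]
  | tmul a b => simp

theorem εs_eq_s5 (W : WeakBialgebra k A) (x : A) :
    W.εs x = (TensorProduct.rid k A)
      ((LinearMap.lTensor A (W.counit ∘ₗ LinearMap.mulLeft k x)) (W.comul 1)) := by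
  simp only [εs, LinearMap.comp_apply, LinearMap.mulRight_apply, TensorProduct.mk_apply]
  induction W.comul 1 with
  | zero => simp
  | add u v hu hv => simp only [mul_add, map_add, hu, hv]
  | tmul a b => simp

theorem contractLeft_one_comul (W : WeakBialgebra k A) (h : A) :
    W.contractLeft 1 (W.comul h) = h := by
  have : W.counitMulRight 1 = W.counit := by
    ext; simp [counitMulRight]
  simpa [contractLeft, this] using W.counit_comul h

theorem mul_contractLeft (W : WeakBialgebra k A) (h y : A) (u : A ⊗[k] A) :
    h * W.contractLeft y u = W.contractLeft y ((LinearMap.lTensor A (LinearMap.mulLeft k h)) u) := by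
  induction u with
  | zero => simp
  | add u v hu hv => simp only [mul_add, map_add, hu, hv]
  | tmul a b => simp

/-- `ε(g₁ y) ε(p g₂) = ε(p g y)`, tensored with a pair `D = p ⊗ q` and a third leg `c`. -/
theorem contractLeft_assoc_comul (W : WeakBialgebra k A) (D : A ⊗[k] A) (g c y : A) :
    W.contractLeft y
        ((LinearMap.lTensor A (W.contractLeft 1 ∘ₗ LinearMap.mulLeft k D))
          ((TensorProduct.assoc k A A A) (W.comul g ⊗ₜ[k] c))) =
      W.contractLeft y (D * (g ⊗ₜ[k] c)) := by
  induction D with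
  | zero => simp
  | add D E hD hE =>
    have : LinearMap.mulLeft k (D + E) = LinearMap.mulLeft k D + LinearMap.mulLeft k E := by
      ext; simp [add_mul]
    simp only [this, LinearMap.comp_add, LinearMap.lTensor_add, LinearMap.add_apply, map_add,
      add_mul, hD, hE]
  | tmul p q =>
    rw [Algebra.TensorProduct.tmul_mul_tmul, contractLeft_tmul, W.counit_weak']
    induction W.comul g with
    | zero => simp
    | add u v hu hv => simp only [add_tmul, map_add, hu, hv, add_smul]
    | tmul a b => simp [smul_smul]

/-- `ε(h₁ y) h₂ = h εt(y)`. -/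
theorem contractLeft_comul (W : WeakBialgebra k A) (h y : A) :
    W.contractLeft y (W.comul h) = h * W.εt y := by
  have hL : LinearMap.mulLeft k h =
      (W.contractLeft 1 ∘ₗ LinearMap.mulLeft k (W.comul h)) ∘ₗ W.comul := by
    ext g
    simp [← W.comul_mul, contractLeft_one_comul]
  rw [εt_eq_contractLeft, mul_contractLeft, hL, LinearMap.lTensor_comp, LinearMap.comp_apply,
    ← W.coassoc]
  conv_lhs => rw [← mul_one h, W.comul_mul]
  induction W.comul 1 with
  | zero => simp
  | add u v hu hv => simp only [mul_add, map_add, hu, hv]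
  | tmul g c => rw [LinearMap.rTensor_tmul, contractLeft_assoc_comul]

/-- For commutative `A`, the target counital map is multiplicative. -/
theorem εt_mul_of_comm (W : WeakBialgebra k A) (hcomm : ∀ a b : A, a * b = b * a) (a b : A) :
    W.εt (a * b) = W.εt a * W.εt b := by
  have hR : LinearMap.mulLeft k (W.εt b) = W.contractLeft b ∘ₗ W.comul := by
    ext g
    simp [contractLeft_comul, hcomm]
  rw [hcomm (W.εt a), εt_eq_contractLeft W a, mul_contractLeft, hR, LinearMap.lTensor_comp,
    LinearMap.comp_apply, ← W.coassoc, εt_eq_contractLeft]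
  induction W.comul 1 with
  | zero => simp
  | add u v hu hv => simp only [map_add, hu, hv]
  | tmul g c =>
    rw [contractLeft_tmul, ← mul_assoc, hcomm g a, W.counit_weak, LinearMap.rTensor_tmul]
    induction W.comul g with
    | zero => simp
    | add u v hu hv => simp only [add_tmul, map_add, ← hu, ← hv, add_smul]
    | tmul p q => simp [smul_smul, hcomm a p, mul_comm]

/-- For commutative `A`, `εt ∘ εs = εt`. -/
theorem εt_εs_of_comm (W : WeakBialgebra k A) (hcomm : ∀ a b : A, a * b = b * a) (x : A) :
    W.εt (W.εs x) = W.εt x := by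
  have hF : W.counitMulRight (W.εs x) = W.counitMulRight x := by
    ext g
    have hw := W.counit_weak g 1 x
    rw [mul_one] at hw
    simp only [counitMulRight, LinearMap.comp_apply, LinearMap.mulRight_apply, hw, εs_eq_s5]
    induction W.comul 1 with
    | zero => simp
    | add u v hu hv => simp only [mul_add, map_add, hu, hv]
    | tmul p q => simp [hcomm x q, mul_comm]
  rw [εt_eq_contractLeft, εt_eq_contractLeft, contractLeft, hF, contractLeft]

end WeakBialgebra

theorem epsT_of_act
    {k H A : Type*} [Field k] [Ring H] [Algebra k H] [Ring A] [Algebra k A]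
    (WH : WeakBialgebra k H) (WA : WeakBialgebra k A)
    (act : H →ₗ[k] A →ₗ[k] A) (hMA : IsModuleAlgebra k WH act)
    (hcomm : ∀ a b : A, a * b = b * a)
    (h4 : ∀ (h : H) (x : A), WA.εs (act h x) = WA.εs (act h 1) * WA.εs x) :
    ∀ (h : H) (x : A), WA.εt (act h x) = WA.εt (act h 1) * WA.εt x := by
  intro h x
  rw [← WA.εt_εs_of_comm hcomm, h4, WA.εt_mul_of_comm hcomm, WA.εt_εs_of_comm hcomm,
    WA.εt_εs_of_comm hcomm]

end WeakSmash
end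
end

section
/- Let H and A be weak Hopf algebras, let H act on A via a functional λ (h·a = λ(h)a) and let A coact on H via a group-like idempotent z (ρ(h) = h⊗z). Then (H,A) is a weak matched pair if and only if λ(h₁)h₂λ(h₃) = λ(h₁)h₂ for all h ∈ H and zxz = xz for all x ∈ A. In particular, if H is cocommutative and A is commutative, these conditions hold and (H,A) is an abelian weak matched pair. -/
open TensorProduct

noncomputable section

namespace WeakSmash

/-- In a semigroup, if an idempotent `z` has a generalized inverse `w` such that `z w` and `w z`
commute, then both products equal `z`. -/
theorem idempotent_eq_of_commute {M : Type*} [Semigroup M] {z w : M} (hz : z * z = z)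
    (hw : w * (z * w) = w) (hzw : z * w * z = z)
    (hc : (z * w) * (w * z) = (w * z) * (z * w)) : w * z = z ∧ z * w = z := by
  have h : z * (w * (w * z)) = w := by
    rw [← mul_assoc z, hc, mul_assoc, ← mul_assoc z z, hz, hw]
  have hl : z * w = w := by
    conv_lhs => rw [← h, ← mul_assoc, hz]
    exact h
  have hr : w * z = w := by
    conv_lhs => rw [← h, mul_assoc, mul_assoc, mul_assoc, hz]
    exact h
  rw [hl, hr] at hzw
  subst hzw
  exact ⟨hz, hz⟩

namespace WeakBialgebra

variable {k H : Type*} [Field k] [Ring H] [Algebra k H] (W : WeakBialgebra k H)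

theorem mul'_map_εt_comul (h : H) :
    LinearMap.mul' k H (TensorProduct.map W.εt LinearMap.id (W.comul h)) = h := by
  have key : ∀ V T : H ⊗[k] H,
      LinearMap.mul' k H (TensorProduct.map
        ((TensorProduct.lid k H).toLinearMap ∘ₗ LinearMap.rTensor H W.counit ∘ₗ
          LinearMap.mulLeft k V ∘ₗ (TensorProduct.mk k H H).flip 1) LinearMap.id T) =
      TensorProduct.lid k H (LinearMap.rTensor H W.counit (V * T)) := by
    intro V T
    induction T with
    | zero => simp
    | add T T' hT hT' => simp only [map_add, mul_add, hT, hT']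
    | tmul a b =>
      induction V with
      | zero => simp
      | add V V' hV hV' =>
        simp only [TensorProduct.map_tmul, LinearMap.mul'_apply, LinearMap.comp_apply,
          LinearMap.mulLeft_apply, add_mul, map_add] at hV hV' ⊢
        rw [hV, hV']
      | tmul c d => simp
  have := key (W.comul 1) (W.comul h)
  rw [← W.comul_mul, one_mul, W.counit_comul] at this
  exact this

theorem εt_commute_εs (g h : H) : W.εt g * W.εs h = W.εs h * W.εt g := by
  have key : ∀ V U : H ⊗[k] H,
      (TensorProduct.lid k H (LinearMap.rTensor H W.counit (V * g ⊗ₜ 1))) *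
        (TensorProduct.rid k H (LinearMap.lTensor H W.counit (1 ⊗ₜ h * U))) =
      TensorProduct.lid k H (TensorProduct.map (W.counit ∘ₗ LinearMap.mulRight k g)
        ((TensorProduct.rid k H).toLinearMap ∘ₗ
          LinearMap.lTensor H (W.counit ∘ₗ LinearMap.mulLeft k h))
        ((TensorProduct.assoc k H H H) (V ⊗ₜ[k] (1 : H)) * ((1 : H) ⊗ₜ[k] U))) ∧
      (TensorProduct.rid k H (LinearMap.lTensor H W.counit (1 ⊗ₜ h * U))) *
        (TensorProduct.lid k H (LinearMap.rTensor H W.counit (V * g ⊗ₜ 1))) =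
      TensorProduct.lid k H (TensorProduct.map (W.counit ∘ₗ LinearMap.mulRight k g)
        ((TensorProduct.rid k H).toLinearMap ∘ₗ
          LinearMap.lTensor H (W.counit ∘ₗ LinearMap.mulLeft k h))
        (((1 : H) ⊗ₜ[k] U) * (TensorProduct.assoc k H H H) (V ⊗ₜ[k] (1 : H)))) := by
    intro V U
    induction V with
    | zero => simp
    | add V V' hV hV' =>
      simp only [TensorProduct.add_tmul, add_mul, mul_add, map_add, hV, hV', and_self]
    | tmul a b =>
      induction U with
      | zero => simp
      | add U U' hU hU' =>
        simp only [TensorProduct.tmul_add, add_mul, mul_add, map_add, hU, hU', and_self]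
      | tmul c d => constructor <;> simp [smul_smul, mul_comm]
  obtain ⟨h₁, h₂⟩ := key (W.comul 1) (W.comul 1)
  rw [W.comul_one_left, ← W.comul_one_right, ← h₂] at h₁
  exact h₁

theorem εs_one : W.εs 1 = 1 := by
  simpa [εs, ← Algebra.TensorProduct.one_def] using W.comul_counit 1

/-- Convolution of linear functionals. -/
def conv (f g : H →ₗ[k] k) : H →ₗ[k] k :=
  LinearMap.mul' k k ∘ₗ TensorProduct.map f g ∘ₗ W.comul

theorem conv_assoc (f g e : H →ₗ[k] k) : W.conv (W.conv f g) e = W.conv f (W.conv g e) := by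
  ext h
  have key : ∀ T : (H ⊗[k] H) ⊗[k] H,
      LinearMap.mul' k k (TensorProduct.map (LinearMap.mul' k k ∘ₗ TensorProduct.map f g) e T) =
      LinearMap.mul' k k (TensorProduct.map f (LinearMap.mul' k k ∘ₗ TensorProduct.map g e)
        (TensorProduct.assoc k H H H T)) := by
    intro T
    rw [← LinearMap.comp_apply, ← LinearMap.comp_apply, ← LinearEquiv.coe_toLinearMap,
      ← LinearMap.comp_apply]
    congr 1
    ext a b c
    simp [mul_assoc]
  have := key (LinearMap.rTensor H W.comul (W.comul h))
  rw [W.coassoc] at this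
  simpa only [conv, LinearMap.rTensor, LinearMap.lTensor, LinearMap.comp_apply,
    TensorProduct.map_map, LinearMap.comp_id, LinearMap.comp_assoc] using this

/-- The convolution semigroup of linear functionals. -/
abbrev convSemigroup : Semigroup (H →ₗ[k] k) where
  mul := W.conv
  mul_assoc := W.conv_assoc

variable {W} {S : H →ₗ[k] H}

theorem IsAntipode.εs_eq_of_groupLike (hS : W.IsAntipode S) {z : H} (hz : z * z = z)
    (hΔ : W.comul z = z ⊗ₜ z) : W.εs z = z := by
  have ht : z * S z = W.εt z := by simpa [hΔ] using hS.mul_antipode z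
  have hs : S z * z = W.εs z := by simpa [hΔ] using hS.antipode_mul z
  have hm : S z * (z * S z) = S z := by simpa [hΔ] using hS.antipode_mid z
  have hl : W.εt z * z = z := by simpa [hΔ] using W.mul'_map_εt_comul z
  rw [← hs]
  exact (idempotent_eq_of_commute hz hm (by rw [ht, hl])
    (by rw [ht, hs, W.εt_commute_εs])).1

theorem conv_εt_εs (W : WeakBialgebra k H) (f g : H →ₗ[k] k) :
    W.conv (f ∘ₗ W.εt) (g ∘ₗ W.εs) = W.conv (g ∘ₗ W.εs) (f ∘ₗ W.εt) := by
  ext h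
  have key : ∀ V U : H ⊗[k] H,
      LinearMap.mul' k k (TensorProduct.map
        (f ∘ₗ (TensorProduct.lid k H).toLinearMap ∘ₗ LinearMap.rTensor H W.counit ∘ₗ
          LinearMap.mulLeft k V ∘ₗ (TensorProduct.mk k H H).flip 1)
        (g ∘ₗ (TensorProduct.rid k H).toLinearMap ∘ₗ LinearMap.lTensor H W.counit ∘ₗ
          LinearMap.mulRight k U ∘ₗ TensorProduct.mk k H H 1) (W.comul h)) =
      LinearMap.mul' k k (TensorProduct.map
        (g ∘ₗ (TensorProduct.rid k H).toLinearMap ∘ₗ LinearMap.lTensor H W.counit ∘ₗ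
          LinearMap.mulRight k U ∘ₗ TensorProduct.mk k H H 1)
        (f ∘ₗ (TensorProduct.lid k H).toLinearMap ∘ₗ LinearMap.rTensor H W.counit ∘ₗ
          LinearMap.mulLeft k V ∘ₗ (TensorProduct.mk k H H).flip 1) (W.comul h)) := by
    intro V U
    induction V with
    | zero =>
      simp only [LinearMap.mulLeft_zero_eq_zero, LinearMap.zero_comp, LinearMap.comp_zero,
        TensorProduct.map_zero_left, TensorProduct.map_zero_right, LinearMap.zero_apply]
    | add V V' hV hV' =>
      have : LinearMap.mulLeft k (V + V') = LinearMap.mulLeft k V + LinearMap.mulLeft k V' := by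
        ext; simp [add_mul]
      simp only [this, LinearMap.add_comp, LinearMap.comp_add, TensorProduct.map_add_left,
        TensorProduct.map_add_right, LinearMap.add_apply, map_add, hV, hV']
    | tmul a b =>
      induction U with
      | zero =>
        simp only [LinearMap.mulRight_zero_eq_zero, LinearMap.zero_comp, LinearMap.comp_zero,
          TensorProduct.map_zero_left, TensorProduct.map_zero_right, LinearMap.zero_apply]
      | add V V' hV hV' =>
        have : LinearMap.mulRight k (V + V') =
            LinearMap.mulRight k V + LinearMap.mulRight k V' := by
          ext; simp [mul_add]
        simp only [this, LinearMap.add_comp, LinearMap.comp_add, TensorProduct.map_add_left,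
          TensorProduct.map_add_right, LinearMap.add_apply, map_add, hV, hV']
      | tmul c d =>
        have e₁ : f ∘ₗ (TensorProduct.lid k H).toLinearMap ∘ₗ LinearMap.rTensor H W.counit ∘ₗ
            LinearMap.mulLeft k (a ⊗ₜ[k] b) ∘ₗ (TensorProduct.mk k H H).flip 1 =
            f b • (W.counit ∘ₗ LinearMap.mulLeft k a) := by
          ext; simp [mul_comm]
        have e₂ : g ∘ₗ (TensorProduct.rid k H).toLinearMap ∘ₗ LinearMap.lTensor H W.counit ∘ₗ
            LinearMap.mulRight k (c ⊗ₜ[k] d) ∘ₗ TensorProduct.mk k H H 1 =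
            g c • (W.counit ∘ₗ LinearMap.mulRight k d) := by
          ext; simp [mul_comm]
        have hcomm : ∀ (p q : H →ₗ[k] k) (T : H ⊗[k] H),
            LinearMap.mul' k k (TensorProduct.map p q T) =
            LinearMap.mul' k k (TensorProduct.map q p (TensorProduct.comm k H H T)) := by
          intro p q T
          induction T with
          | zero => simp
          | add T T' hT hT' => simp only [map_add, hT, hT']
          | tmul x y => simp [mul_comm]
        rw [e₁, e₂, hcomm (g c • _)]
        simp only [TensorProduct.map_smul_left, TensorProduct.map_smul_right,
          LinearMap.smul_apply, map_smul]
        rw [← W.counit_weak, ← W.counit_weak']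
  exact key (W.comul 1) (W.comul 1)

theorem IsAntipode.comp_εt_eq (hS : W.IsAntipode S) {f : H →ₗ[k] k} (hf : W.conv f f = f)
    (hmul : ∀ g h : H, f (g * h) = f g * f h) : f ∘ₗ W.εt = f := by
  have hm : ∀ (T : H ⊗[k] H), f (LinearMap.mul' k H T) =
      LinearMap.mul' k k (TensorProduct.map f f T) := by
    intro T
    induction T with
    | zero => simp
    | add T T' hT hT' => simp only [map_add, hT, hT']
    | tmul x y => simp [hmul]
  have ht : W.conv f (f ∘ₗ S) = f ∘ₗ W.εt := by
    ext h
    simp only [conv, LinearMap.comp_apply, ← hS.mul_antipode, hm, LinearMap.lTensor,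
      TensorProduct.map_map, LinearMap.comp_id]
  have hs : W.conv (f ∘ₗ S) f = f ∘ₗ W.εs := by
    ext h
    simp only [conv, LinearMap.comp_apply, ← hS.antipode_mul, hm, LinearMap.rTensor,
      TensorProduct.map_map, LinearMap.comp_id]
  have hw : W.conv (f ∘ₗ S) (W.conv f (f ∘ₗ S)) = f ∘ₗ S := by
    ext h
    have e : f ∘ₗ LinearMap.mul' k H ∘ₗ LinearMap.lTensor H S =
        LinearMap.mul' k k ∘ₗ TensorProduct.map f (f ∘ₗ S) := by
      ext; simp [hmul]
    conv_rhs => rw [LinearMap.comp_apply, ← hS.antipode_mid, hm]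
    simp only [conv, LinearMap.comp_apply, LinearMap.lTensor, TensorProduct.map_map,
      LinearMap.comp_id, ← LinearMap.comp_assoc] at e ⊢
    rw [e]
  have hl : W.conv (f ∘ₗ W.εt) f = f := by
    ext h
    conv_rhs => rw [← W.mul'_map_εt_comul h, hm]
    simp only [conv, LinearMap.comp_apply, TensorProduct.map_map, LinearMap.comp_id]
  rw [← ht]
  refine (@idempotent_eq_of_commute _ W.convSemigroup f (f ∘ₗ S) hf hw ?_ ?_).2
  · change W.conv (W.conv f (f ∘ₗ S)) f = f
    rw [ht, hl]
  · change W.conv (W.conv f (f ∘ₗ S)) (W.conv (f ∘ₗ S) f) =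
      W.conv (W.conv (f ∘ₗ S) f) (W.conv f (f ∘ₗ S))
    rw [ht, hs, conv_εt_εs]

end WeakBialgebra

section ScalarPair

variable {k H A : Type*} [Field k] [Ring H] [Algebra k H] [Ring A] [Algebra k A]

/-- The contraction `h ↦ λ(h₁) h₂`. -/
def contractLeft (WH : WeakBialgebra k H) (lam : H →ₗ[k] k) : H →ₗ[k] H :=
  (TensorProduct.lid k H).toLinearMap ∘ₗ LinearMap.rTensor H lam ∘ₗ WH.comul

/-- The contraction `h ↦ λ(h₁) h₂ λ(h₃)`. -/
def contractBoth (WH : WeakBialgebra k H) (lam : H →ₗ[k] k) : H →ₗ[k] H :=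
  (TensorProduct.lid k H).toLinearMap ∘ₗ LinearMap.rTensor H lam ∘ₗ
    LinearMap.lTensor H ((TensorProduct.rid k H).toLinearMap ∘ₗ LinearMap.lTensor H lam) ∘ₗ
      twoComul k WH

/-- The map `u ↦ x₁ ⊗ u g ⊗ x₂ z`, for `X = x₁ ⊗ x₂`. -/
def insertMul (X : A ⊗[k] A) (z : A) (g : H) : H →ₗ[k] (A ⊗[k] H) ⊗[k] A :=
  LinearMap.lTensor (A ⊗[k] H) (LinearMap.mul' k A) ∘ₗ
    (TensorProduct.tensorTensorTensorComm k A A H A).toLinearMap ∘ₗ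
      TensorProduct.mk k (A ⊗[k] A) (H ⊗[k] A) X ∘ₗ
        (TensorProduct.mk k H A).flip z ∘ₗ LinearMap.mulRight k g

theorem insertMul_tmul (x y z : A) (g u : H) :
    insertMul (x ⊗ₜ[k] y) z g u = (x ⊗ₜ (u * g)) ⊗ₜ (y * z) := by
  simp [insertMul]

theorem insertMul_add (X Y : A ⊗[k] A) (z : A) (g u : H) :
    insertMul (X + Y) z g u = insertMul X z g u + insertMul Y z g u := by
  simp [insertMul]

theorem insertMul_zero (z : A) (g u : H) : insertMul (0 : A ⊗[k] A) z g u = 0 := by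
  simp [insertMul]

theorem insertMul_lTensor_mulLeft {z : A} (hz : ∀ x : A, z * x * z = x * z) (X : A ⊗[k] A)
    (g u : H) :
    insertMul (LinearMap.lTensor A (LinearMap.mulLeft k z) X) z g u = insertMul X z g u := by
  induction X with
  | zero => simp
  | add X Y hX hY => simp only [map_add, insertMul_add, hX, hY]
  | tmul x y => simp [insertMul_tmul, hz]

theorem counit_insertMul (f : A →ₗ[k] k) (X : A ⊗[k] A) (z : A) (g u : H) :
    LinearMap.rTensor A ((TensorProduct.lid k H).toLinearMap ∘ₗ LinearMap.rTensor H f)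
        (insertMul X z g u) =
      (u * g) ⊗ₜ (TensorProduct.lid k A (LinearMap.rTensor A f X) * z) := by
  induction X with
  | zero => simp [insertMul_zero]
  | add X Y hX hY => simp only [insertMul_add, map_add, hX, hY, add_mul, TensorProduct.tmul_add]
  | tmul x y => simp [insertMul_tmul, TensorProduct.smul_tmul]

variable (WH : WeakBialgebra k H) (WA : WeakBialgebra k A) (lam : H →ₗ[k] k) (z : A)

theorem mpLHS_scalar (h g : H) (x : A) :
    mpLHS k WH WA (LinearMap.lsmul k A ∘ₗ lam) ((TensorProduct.mk k H A).flip z) h g x =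
      insertMul (WA.comul x) z g (contractLeft WH lam h) := by
  simp only [mpLHS, contractLeft, LinearMap.comp_apply]
  induction WH.comul h with
  | zero => simp
  | add T T' hT hT' => simp only [map_add, hT, hT']
  | tmul a b => simp [insertMul, TensorProduct.smul_tmul]

theorem pairMapA_scalar (X : A ⊗[k] A) (a b : H) :
    pairMapA k (LinearMap.lsmul k A ∘ₗ lam) ((TensorProduct.mk k H A).flip z)
        ((a ⊗ₜ b) ⊗ₜ X) =
      (lam a * lam b) • LinearMap.lTensor A (LinearMap.mulLeft k z) X := by
  induction X with
  | zero => simp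
  | add X Y hX hY => simp only [TensorProduct.tmul_add, map_add, hX, hY, smul_add]
  | tmul x y => simp [pairMapA, TensorProduct.smul_tmul, smul_smul, mul_comm]

theorem pairMapH_scalar {z : A} (hz : z * z = z) (c d g : H) :
    pairMapH k (LinearMap.lsmul k A ∘ₗ lam) ((TensorProduct.mk k H A).flip z)
        ((c ⊗ₜ d) ⊗ₜ (g ⊗ₜ z)) = lam d • ((c * g) ⊗ₜ z) := by
  simp [pairMapH, hz]

variable {WH lam} in
theorem contractBoth_eq_threeComul
    (hlam : ∀ h : H, LinearMap.mul' k k (TensorProduct.map lam lam (WH.comul h)) = lam h)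
    (h : H) :
    TensorProduct.lid k H (TensorProduct.map lam ((TensorProduct.lid k H).toLinearMap ∘ₗ
      TensorProduct.map lam ((TensorProduct.rid k H).toLinearMap ∘ₗ LinearMap.lTensor H lam))
        (threeComul k WH h)) = contractBoth WH lam h := by
  simp only [threeComul, contractBoth, twoComul]
  set R : H ⊗[k] H →ₗ[k] H := (TensorProduct.rid k H).toLinearMap ∘ₗ LinearMap.lTensor H lam
  have key : ∀ T : (H ⊗[k] H) ⊗[k] H,
      TensorProduct.lid k H (TensorProduct.map lam ((TensorProduct.lid k H).toLinearMap ∘ₗ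
        TensorProduct.map lam (R ∘ₗ WH.comul)) (TensorProduct.assoc k H H H T)) =
      TensorProduct.lid k H (TensorProduct.map (LinearMap.mul' k k ∘ₗ TensorProduct.map lam lam)
        (R ∘ₗ WH.comul) T) := by
    intro T
    induction T with
    | zero => simp
    | add T T' hT hT' => simp only [map_add, hT, hT']
    | tmul u c =>
      induction u with
      | zero => simp
      | add u u' hu hu' => simp only [TensorProduct.add_tmul, map_add, hu, hu']
      | tmul a b => simp [smul_smul, mul_comm]
  have hl : LinearMap.mul' k k ∘ₗ TensorProduct.map lam lam ∘ₗ WH.comul = lam :=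
    LinearMap.ext hlam
  have := key (LinearMap.rTensor H WH.comul (WH.comul h))
  rw [WH.coassoc] at this
  have hR : TensorProduct.map lam R ∘ₗ TensorProduct.map LinearMap.id WH.comul ∘ₗ WH.comul =
      TensorProduct.map lam (R ∘ₗ WH.comul) ∘ₗ WH.comul := by
    rw [← LinearMap.comp_assoc, ← TensorProduct.map_comp, LinearMap.comp_id]
  simpa only [LinearMap.rTensor, LinearMap.lTensor, LinearMap.comp_apply, LinearEquiv.coe_coe,
    TensorProduct.map_map, LinearMap.comp_id, LinearMap.id_comp, LinearMap.comp_assoc, hl, hR]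
    using this

variable {WH lam z} in
theorem mpRHS_scalar (hz : z * z = z)
    (hlam : ∀ h : H, LinearMap.mul' k k (TensorProduct.map lam lam (WH.comul h)) = lam h)
    (h g : H) (x : A) :
    mpRHS k WH WA (LinearMap.lsmul k A ∘ₗ lam) ((TensorProduct.mk k H A).flip z) h g x =
      insertMul (LinearMap.lTensor A (LinearMap.mulLeft k z) (WA.comul x)) z g
        (contractBoth WH lam h) := by
  rw [← contractBoth_eq_threeComul hlam, mpRHS]
  induction threeComul k WH h with
  | zero => simp
  | add T T' hT hT' => simp only [map_add, hT, hT']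
  | tmul a T =>
    induction T with
    | zero => simp
    | add T T' hT hT' => simp only [TensorProduct.tmul_add, map_add, hT, hT']
    | tmul b T =>
      induction T with
      | zero => simp
      | add T T' hT hT' => simp only [TensorProduct.tmul_add, map_add, hT, hT']
      | tmul c d =>
        simp only [TensorProduct.assoc_symm_tmul, TensorProduct.map_tmul, LinearMap.comp_apply,
          LinearMap.flip_apply, TensorProduct.mk_apply, pairMapA_scalar, pairMapH_scalar _ hz]
        simp [insertMul, ← TensorProduct.smul_tmul', smul_smul, mul_comm, mul_left_comm]

variable {WH WA lam z}

theorem coactCounit_flip_mk (h : H) :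
    coactCounit k WH ((TensorProduct.mk k H A).flip z) h = WH.counit h • z := by
  simp [coactCounit]

theorem isModuleAlgebra_scalar {SH : H →ₗ[k] H} (hSH : WH.IsAntipode SH) (hlam1 : lam 1 = 1)
    (hlam2 : ∀ h : H, LinearMap.mul' k k (TensorProduct.map lam lam (WH.comul h)) = lam h)
    (hlam3 : ∀ h g : H, lam (h * g) = lam h * lam g) :
    IsModuleAlgebra k WH (LinearMap.lsmul k A ∘ₗ lam) where
  one_act a := by simp [hlam1]
  act_mul h a b := by
    have key : ∀ T : H ⊗[k] H,
        LinearMap.mul' k k (TensorProduct.map lam lam T) • (a * b) =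
        LinearMap.mul' k A (TensorProduct.map ((LinearMap.lsmul k A ∘ₗ lam).flip a)
          ((LinearMap.lsmul k A ∘ₗ lam).flip b) T) := by
      intro T
      induction T with
      | zero => simp
      | add T T' hT hT' => simp only [map_add, add_smul, hT, hT']
      | tmul u v => simp [smul_smul, mul_comm]
    rw [← key, hlam2]
    simp
  act_act h g a := by simp [hlam3, smul_smul, mul_comm]
  act_unit h := by
    have := LinearMap.congr_fun (hSH.comp_εt_eq (LinearMap.ext hlam2) hlam3) h
    simp only [LinearMap.comp_apply] at this
    simp [this]

theorem isComoduleCoalgebra_flip_mk {SA : A →ₗ[k] A} (hSA : WA.IsAntipode SA)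
    (hz1 : WA.counit z = 1) (hz2 : z * z = z) (hz3 : WA.comul z = z ⊗ₜ[k] z) :
    IsComoduleCoalgebra k WH WA ((TensorProduct.mk k H A).flip z) where
  counit_coact h := by simp [hz1]
  comul_coact h := by
    simp only [LinearMap.flip_apply, TensorProduct.mk_apply, LinearMap.rTensor_tmul]
    induction WH.comul h with
    | zero => simp
    | add T T' hT hT' => simp only [TensorProduct.add_tmul, map_add, hT, hT']
    | tmul a b => simp [hz2]
  coact_coact h := by simp [hz3]
  coact_counit h := by
    rw [coactCounit_flip_mk, map_smul, hSA.εs_eq_of_groupLike hz2 hz3]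

theorem isWeakMatchedPair_scalar {SH : H →ₗ[k] H} (hSH : WH.IsAntipode SH) {SA : A →ₗ[k] A}
    (hSA : WA.IsAntipode SA) (hlam1 : lam 1 = 1)
    (hlam2 : ∀ h : H, LinearMap.mul' k k (TensorProduct.map lam lam (WH.comul h)) = lam h)
    (hlam3 : ∀ h g : H, lam (h * g) = lam h * lam g)
    (hz1 : WA.counit z = 1) (hz2 : z * z = z) (hz3 : WA.comul z = z ⊗ₜ[k] z)
    (hP : ∀ h, contractBoth WH lam h = contractLeft WH lam h)
    (hz : ∀ x : A, z * x * z = x * z) :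
    IsWeakMatchedPair k WH WA (LinearMap.lsmul k A ∘ₗ lam)
      ((TensorProduct.mk k H A).flip z) where
  moduleAlgebra := isModuleAlgebra_scalar hSH hlam1 hlam2 hlam3
  comoduleCoalgebra := isComoduleCoalgebra_flip_mk hSA hz1 hz2 hz3
  cond3 h g x := by
    rw [mpLHS_scalar, mpRHS_scalar _ hz2 hlam2, insertMul_lTensor_mulLeft hz, hP]
  cond4 h x := by simp [WA.εs_one]
  cond5 := by
    have key : ∀ T U : H ⊗[k] H,
        TensorProduct.map
          (LinearMap.lTensor H (coactCounit k WH ((TensorProduct.mk k H A).flip z)))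
          (LinearMap.mul' k H) (TensorProduct.tensorTensorTensorComm k H H H H (T ⊗ₜ U)) =
        LinearMap.rTensor H ((TensorProduct.mk k H A).flip z) (LinearMap.lTensor H
          (LinearMap.mulRight k (TensorProduct.lid k H (LinearMap.rTensor H WH.counit U))) T) := by
      intro T U
      induction T with
      | zero => simp
      | add T T' hT hT' => simp only [TensorProduct.add_tmul, map_add, hT, hT']
      | tmul a b =>
        induction U with
        | zero => simp
        | add U U' hU hU' =>
          simp only [LinearMap.lTensor_tmul, LinearMap.mulRight_apply] at hU hU' ⊢
          simp only [TensorProduct.tmul_add, map_add, mul_add, hU, hU']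
        | tmul c d => simp [coactCounit_flip_mk, TensorProduct.smul_tmul]
    rw [key, WH.counit_comul, LinearMap.mulRight_one, LinearMap.lTensor_id_apply]

theorem contractBoth_eq_and_mul_mul_eq_of_cond3 (hlam1 : lam 1 = 1)
    (hlam2 : ∀ h : H, LinearMap.mul' k k (TensorProduct.map lam lam (WH.comul h)) = lam h)
    (hz1 : WA.counit z = 1) (hz2 : z * z = z)
    (h3 : ∀ (h g : H) (x : A),
      mpLHS k WH WA (LinearMap.lsmul k A ∘ₗ lam) ((TensorProduct.mk k H A).flip z) h g x =
      mpRHS k WH WA (LinearMap.lsmul k A ∘ₗ lam) ((TensorProduct.mk k H A).flip z) h g x) :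
    (∀ h, contractBoth WH lam h = contractLeft WH lam h) ∧ ∀ x : A, z * x * z = x * z := by
  have key : ∀ (h : H) (x : A),
      contractLeft WH lam h ⊗ₜ[k] (x * z) = contractBoth WH lam h ⊗ₜ[k] (z * x * z) := by
    intro h x
    have e : ∀ X : A ⊗[k] A, TensorProduct.lid k A (LinearMap.rTensor A WA.counit
        (LinearMap.lTensor A (LinearMap.mulLeft k z) X)) =
        z * TensorProduct.lid k A (LinearMap.rTensor A WA.counit X) := by
      intro X
      induction X with
      | zero => simp
      | add X Y hX hY => simp only [map_add, mul_add, hX, hY]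
      | tmul x y => simp
    have := congrArg (LinearMap.rTensor A ((TensorProduct.lid k H).toLinearMap ∘ₗ
      LinearMap.rTensor H WA.counit)) (h3 h 1 x)
    rwa [mpLHS_scalar, mpRHS_scalar _ hz2 hlam2, counit_insertMul, counit_insertMul, e,
      WA.counit_comul, mul_one, mul_one] at this
  have hP : ∀ h, contractBoth WH lam h = contractLeft WH lam h := by
    intro h
    have := congrArg (fun T => TensorProduct.rid k H (LinearMap.lTensor H WA.counit T)) (key h 1)
    simpa [hz1, hz2] using this.symm
  refine ⟨hP, fun x => ?_⟩
  have hlam : lam (contractLeft WH lam 1) = 1 := by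
    conv_rhs => rw [← hlam1, ← hlam2]
    simp only [contractLeft, LinearMap.comp_apply]
    induction WH.comul 1 with
    | zero => simp
    | add T T' hT hT' => simp only [map_add, hT, hT']
    | tmul a b => simp
  have := congrArg (fun T => TensorProduct.lid k A (LinearMap.rTensor A lam T)) (key 1 x)
  simpa [hP, hlam] using this.symm

theorem contractBoth_eq_of_cocomm (hc : WH.Cocomm)
    (hlam : ∀ h : H, LinearMap.mul' k k (TensorProduct.map lam lam (WH.comul h)) = lam h)
    (h : H) : contractBoth WH lam h = contractLeft WH lam h := by
  have hR : ((TensorProduct.rid k H).toLinearMap ∘ₗ LinearMap.lTensor H lam) ∘ₗ WH.comul =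
      contractLeft WH lam := by
    ext u
    rw [contractLeft]
    simp only [LinearMap.comp_apply]
    conv_rhs => rw [← hc]
    induction WH.comul u with
    | zero => simp
    | add T T' hT hT' => simp only [map_add, hT, hT']
    | tmul a b => simp
  have key : ∀ T : (H ⊗[k] H) ⊗[k] H,
      TensorProduct.lid k H (TensorProduct.map lam ((TensorProduct.lid k H).toLinearMap ∘ₗ
        LinearMap.rTensor H lam) (TensorProduct.assoc k H H H T)) =
      TensorProduct.lid k H
        (LinearMap.rTensor H (LinearMap.mul' k k ∘ₗ TensorProduct.map lam lam) T) := by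
    intro T
    induction T with
    | zero => simp
    | add T T' hT hT' => simp only [map_add, hT, hT']
    | tmul u c =>
      induction u with
      | zero => simp
      | add u u' hu hu' => simp only [TensorProduct.add_tmul, map_add, hu, hu']
      | tmul a b => simp [smul_smul, mul_comm]
  have hl : LinearMap.mul' k k ∘ₗ TensorProduct.map lam lam ∘ₗ WH.comul = lam :=
    LinearMap.ext hlam
  have := key (LinearMap.rTensor H WH.comul (WH.comul h))
  rw [WH.coassoc] at this
  simp only [LinearMap.rTensor, LinearMap.lTensor, contractLeft,
    contractBoth, twoComul, LinearMap.comp_apply, LinearEquiv.coe_coe, TensorProduct.map_map,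
    LinearMap.comp_id, LinearMap.id_comp, LinearMap.comp_assoc, hl] at this hR ⊢
  rw [hR, this]

end ScalarPair

theorem lambda_z_weakMatchedPair
    {k H A : Type*} [Field k] [Ring H] [Algebra k H] [Ring A] [Algebra k A]
    (WH : WeakBialgebra k H) (WA : WeakBialgebra k A)
    (SH : H →ₗ[k] H) (SA : A →ₗ[k] A)
    (hSH : WH.IsAntipode SH) (hSA : WA.IsAntipode SA)
    (lam : H →ₗ[k] k) (z : A)
    (hlam1 : lam 1 = 1)
    (hlam2 : ∀ h : H,
      LinearMap.mul' k k ((TensorProduct.map lam lam) (WH.comul h)) = lam h)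
    (hlam3 : ∀ h g : H, lam (h * g) = lam h * lam g)
    (hz1 : WA.counit z = 1) (hz2 : z * z = z) (hz3 : WA.comul z = z ⊗ₜ[k] z) :
    (IsWeakMatchedPair k WH WA (LinearMap.lsmul k A ∘ₗ lam)
        ((TensorProduct.mk k H A).flip z) ↔
      ((∀ h : H,
          (TensorProduct.lid k H)
            ((LinearMap.rTensor H lam)
              ((LinearMap.lTensor H
                  ((TensorProduct.rid k H).toLinearMap ∘ₗ LinearMap.lTensor H lam))
                (twoComul k WH h))) =
          (TensorProduct.lid k H) ((LinearMap.rTensor H lam) (WH.comul h))) ∧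
        (∀ x : A, z * x * z = x * z))) ∧
    ((WH.Cocomm ∧ (∀ a b : A, a * b = b * a)) →
      ((∀ h : H,
          (TensorProduct.lid k H)
            ((LinearMap.rTensor H lam)
              ((LinearMap.lTensor H
                  ((TensorProduct.rid k H).toLinearMap ∘ₗ LinearMap.lTensor H lam))
                (twoComul k WH h))) =
          (TensorProduct.lid k H) ((LinearMap.rTensor H lam) (WH.comul h))) ∧
        (∀ x : A, z * x * z = x * z) ∧
        IsWeakMatchedPair k WH WA (LinearMap.lsmul k A ∘ₗ lam)
          ((TensorProduct.mk k H A).flip z))) := by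
  have of_conditions := isWeakMatchedPair_scalar hSH hSA hlam1 hlam2 hlam3 hz1 hz2 hz3
  refine ⟨⟨fun hp => contractBoth_eq_and_mul_mul_eq_of_cond3 hlam1 hlam2 hz1 hz2 hp.cond3,
    fun ⟨hP, hz⟩ => of_conditions hP hz⟩, fun ⟨hc, hA⟩ => ?_⟩
  have hP := contractBoth_eq_of_cocomm hc hlam2
  have hz : ∀ x : A, z * x * z = x * z := fun x => by rw [hA z x, mul_assoc, hz2]
  exact ⟨hP, hz, of_conditions hP hz⟩


end WeakSmash
end
end

section
/- Let G be a finite abelian group whose order is invertible in the field k, and let H^G be the associated weak Hopf algebra. Then (H^G, H^G), with H^G acting on itself by multiplication and coacting on itself by its comultiplication, is an abelian weak matched pair. -/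
open TensorProduct

noncomputable section

namespace WeakSmash

section Commutative

variable {k : Type*} [Field k] {H : Type*} [CommRing H] [Algebra k H]

theorem pairMapA_mul_tmul (coact : H →ₗ[k] H ⊗[k] H) (a b : H) (t : H ⊗[k] H) :
    pairMapA k (LinearMap.mul k H) coact ((a ⊗ₜ[k] b) ⊗ₜ[k] t) =
      coact a * ((1 : H) ⊗ₜ[k] b) * t := by
  induction t with
  | zero => simp
  | add s t hs ht => rw [TensorProduct.tmul_add, map_add, hs, ht, mul_add]
  | tmul x y =>
    simp only [pairMapA, LinearMap.comp_apply, LinearEquiv.coe_coe,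
      TensorProduct.tensorTensorTensorComm_tmul, TensorProduct.map_tmul,
      LinearMap.rTensor_tmul]
    induction coact a with
    | zero => simp
    | add s t hs ht => simp only [TensorProduct.add_tmul, map_add, hs, ht, add_mul]
    | tmul c d => simp [mul_assoc]

theorem pairMapH_mul (coact : H →ₗ[k] H ⊗[k] H) :
    pairMapH k (LinearMap.mul k H) coact = pairMapA k (LinearMap.mul k H) coact := rfl

theorem pairMapA_mul_comul (W : WeakBialgebra k H)
    (hsep : ∀ a b : H, W.comul a * ((1 : H) ⊗ₜ[k] b) = W.comul (a * b)) (x : H) :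
    pairMapA k (LinearMap.mul k H) W.comul ∘ₗ
        (TensorProduct.mk k (H ⊗[k] H) (H ⊗[k] H)).flip (W.comul x) =
      (W.comul ∘ₗ LinearMap.mulRight k x) ∘ₗ LinearMap.mul' k H := by
  ext a b
  simp [pairMapA_mul_tmul, hsep, W.comul_mul]

theorem map_mul'_threeComul (W : WeakBialgebra k H)
    (hmul : ∀ h : H, LinearMap.mul' k H (W.comul h) = h) (h : H) :
    TensorProduct.map (LinearMap.mul' k H) (LinearMap.mul' k H)
        ((TensorProduct.assoc k H H (H ⊗[k] H)).symm (threeComul k W h)) = W.comul h := by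
  have hid : LinearMap.mul' k H ∘ₗ W.comul = LinearMap.id := LinearMap.ext hmul
  have hlast : (TensorProduct.map (LinearMap.mul' k H) (LinearMap.mul' k H) ∘ₗ
        (TensorProduct.assoc k H H (H ⊗[k] H)).symm.toLinearMap) ∘ₗ
        LinearMap.lTensor H (LinearMap.lTensor H W.comul) =
      LinearMap.rTensor H (LinearMap.mul' k H) ∘ₗ
        (TensorProduct.assoc k H H H).symm.toLinearMap := by
    ext a b c
    simp [hmul]
  have := LinearMap.congr_fun hlast (LinearMap.lTensor H W.comul (W.comul h))
  simp only [LinearMap.comp_apply, LinearEquiv.coe_coe] at this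
  simp only [threeComul, LinearMap.comp_apply]
  rw [this, ← W.coassoc, LinearEquiv.symm_apply_apply, ← LinearMap.comp_apply,
    ← LinearMap.rTensor_comp, hid, LinearMap.rTensor_id, LinearMap.id_apply]

/-- The main compatibility condition of a weak matched pair holds for a commutative weak bialgebra
acting on itself by multiplication and coacting by comultiplication, as soon as the
comultiplication is a bilinear section of the multiplication. -/
theorem mpLHS_eq_mpRHS_of_separable (W : WeakBialgebra k H)
    (hmul : ∀ h : H, LinearMap.mul' k H (W.comul h) = h)
    (hsep : ∀ a b : H, W.comul a * ((1 : H) ⊗ₜ[k] b) = W.comul (a * b)) (h g x : H) :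
    mpLHS k W W (LinearMap.mul k H) W.comul h g x =
      mpRHS k W W (LinearMap.mul k H) W.comul h g x := by
  have hflip : (LinearMap.mul k H).flip x = LinearMap.mulRight k x := rfl
  rw [mpLHS, mpRHS, pairMapH_mul, pairMapA_mul_comul W hsep, pairMapA_mul_comul W hsep,
    TensorProduct.map_comp (W.comul ∘ₗ LinearMap.mulRight k x) (W.comul ∘ₗ LinearMap.mulRight k g),
    LinearMap.comp_apply, map_mul'_threeComul W hmul, hflip]

theorem εs_apply_of_separable (W : WeakBialgebra k H)
    (hsep : ∀ a b : H, W.comul a * ((1 : H) ⊗ₜ[k] b) = W.comul (a * b)) (h : H) :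
    W.εs h = h := by
  simp only [WeakBialgebra.εs, LinearMap.comp_apply, LinearEquiv.coe_coe,
    LinearMap.mulRight_apply, TensorProduct.mk_apply]
  rw [mul_comm, hsep, one_mul, W.comul_counit]

theorem εt_apply_of_separable (W : WeakBialgebra k H) (hcocomm : W.Cocomm)
    (hsep : ∀ a b : H, W.comul a * ((1 : H) ⊗ₜ[k] b) = W.comul (a * b)) (h : H) :
    W.εt h = h := by
  have hcomm : ∀ a : H, Algebra.TensorProduct.comm k H H (W.comul a) = W.comul a := hcocomm
  have hleft : W.comul 1 * (h ⊗ₜ[k] (1 : H)) = W.comul h := by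
    have := congrArg (Algebra.TensorProduct.comm k H H) (hsep 1 h)
    rwa [map_mul, hcomm, hcomm, Algebra.TensorProduct.comm_tmul, one_mul] at this
  simp only [WeakBialgebra.εt, LinearMap.comp_apply, LinearEquiv.coe_coe,
    LinearMap.mulLeft_apply, LinearMap.flip_apply, TensorProduct.mk_apply]
  rw [hleft, W.counit_comul]

theorem coactCounit_comul (W : WeakBialgebra k H) (h : H) :
    coactCounit k W W.comul h = h :=
  W.counit_comul h

theorem isModuleAlgebra_mul_of_separable (W : WeakBialgebra k H) (hcocomm : W.Cocomm)
    (hmul : ∀ h : H, LinearMap.mul' k H (W.comul h) = h)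
    (hsep : ∀ a b : H, W.comul a * ((1 : H) ⊗ₜ[k] b) = W.comul (a * b)) :
    IsModuleAlgebra k W (LinearMap.mul k H) where
  one_act := one_mul
  act_mul h a b := by
    have hfactor : LinearMap.mul' k H ∘ₗ
        TensorProduct.map ((LinearMap.mul k H).flip a) ((LinearMap.mul k H).flip b) =
        LinearMap.mulRight k (a * b) ∘ₗ LinearMap.mul' k H := by
      ext x y
      simp only [TensorProduct.AlgebraTensorModule.curry_apply, TensorProduct.curry_apply,
        LinearMap.coe_restrictScalars, LinearMap.comp_apply, TensorProduct.map_tmul,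
        LinearMap.flip_apply, LinearMap.mul_apply', LinearMap.mul'_apply,
        LinearMap.mulRight_apply]
      exact mul_mul_mul_comm x a y b
    have := LinearMap.congr_fun hfactor (W.comul h)
    simp only [LinearMap.comp_apply, hmul] at this
    exact this.symm
  act_act h g a := (mul_assoc h g a).symm
  act_unit h := by rw [εt_apply_of_separable W hcocomm hsep]

theorem lTensor_mul'_tensorTensorTensorComm_balanced (s t : H ⊗[k] H) (b : H) :
    LinearMap.lTensor (H ⊗[k] H) (LinearMap.mul' k H)
        (TensorProduct.tensorTensorTensorComm k H H H H (s ⊗ₜ[k] (t * ((1 : H) ⊗ₜ[k] b)))) =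
      LinearMap.lTensor (H ⊗[k] H) (LinearMap.mul' k H)
        (TensorProduct.tensorTensorTensorComm k H H H H ((s * ((1 : H) ⊗ₜ[k] b)) ⊗ₜ[k] t)) := by
  induction s with
  | zero => simp
  | add x y hx hy => simp only [add_mul, TensorProduct.add_tmul, map_add, hx, hy]
  | tmul c d =>
    induction t with
    | zero => simp
    | add x y hx hy => simp only [add_mul, TensorProduct.tmul_add, map_add, hx, hy]
    | tmul x y => simp [mul_assoc, mul_comm b]

theorem lTensor_mul'_map_comul_comul (W : WeakBialgebra k H)
    (hmul : ∀ h : H, LinearMap.mul' k H (W.comul h) = h)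
    (hsep : ∀ a b : H, W.comul a * ((1 : H) ⊗ₜ[k] b) = W.comul (a * b)) (h : H) :
    LinearMap.lTensor (H ⊗[k] H) (LinearMap.mul' k H)
        (TensorProduct.tensorTensorTensorComm k H H H H
          (TensorProduct.map W.comul W.comul (W.comul h))) =
      LinearMap.lTensor (H ⊗[k] H) (LinearMap.mul' k H)
        (TensorProduct.tensorTensorTensorComm k H H H H (W.comul h ⊗ₜ[k] W.comul 1)) := by
  have hfactor : LinearMap.lTensor (H ⊗[k] H) (LinearMap.mul' k H) ∘ₗ
        (TensorProduct.tensorTensorTensorComm k H H H H).toLinearMap ∘ₗ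
        TensorProduct.map W.comul W.comul =
      LinearMap.lTensor (H ⊗[k] H) (LinearMap.mul' k H) ∘ₗ
        (TensorProduct.tensorTensorTensorComm k H H H H).toLinearMap ∘ₗ
        (TensorProduct.mk k _ _).flip (W.comul 1) ∘ₗ W.comul ∘ₗ LinearMap.mul' k H := by
    refine TensorProduct.ext' fun a b => ?_
    have hb : W.comul b = W.comul 1 * ((1 : H) ⊗ₜ[k] b) := by rw [hsep, one_mul]
    simp only [LinearMap.comp_apply, LinearEquiv.coe_coe, TensorProduct.map_tmul,
      LinearMap.flip_apply, TensorProduct.mk_apply, LinearMap.mul'_apply]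
    rw [hb, lTensor_mul'_tensorTensorTensorComm_balanced, hsep]
  have := LinearMap.congr_fun hfactor (W.comul h)
  simpa only [LinearMap.comp_apply, LinearEquiv.coe_coe, LinearMap.flip_apply,
    TensorProduct.mk_apply, hmul] using this

end Commutative

section GroupAlgebra

variable {k : Type*} [Field k] {G : Type*} [CommGroup G]

theorem linearMap_ext_of {M : Type*} [AddCommGroup M] [Module k M]
    {f f' : MonoidAlgebra k G →ₗ[k] M}
    (h : ∀ g : G, f (MonoidAlgebra.of k G g) = f' (MonoidAlgebra.of k G g)) : f = f' := by
  ext g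
  simpa using h g

variable [Fintype G] (W : WeakBialgebra k (MonoidAlgebra k G))

theorem mul'_comul (hcard : (Fintype.card G : k) ≠ 0)
    (hcomul : ∀ g : G,
      W.comul (MonoidAlgebra.of k G g) =
        (Fintype.card G : k)⁻¹ •
          ∑ h : G, (MonoidAlgebra.of k G (g * h)) ⊗ₜ[k] (MonoidAlgebra.of k G h⁻¹))
    (h : MonoidAlgebra k G) :
    LinearMap.mul' k (MonoidAlgebra k G) (W.comul h) = h := by
  suffices LinearMap.mul' k (MonoidAlgebra k G) ∘ₗ W.comul = LinearMap.id from
    LinearMap.congr_fun this h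
  refine linearMap_ext_of fun g => ?_
  rw [LinearMap.comp_apply, hcomul]
  simp only [map_smul, map_sum, LinearMap.mul'_apply, ← map_mul, mul_inv_cancel_right,
    Finset.sum_const, Finset.card_univ, LinearMap.id_apply]
  rw [← Nat.cast_smul_eq_nsmul k, smul_smul, inv_mul_cancel₀ hcard, one_smul]

theorem comul_mul_one_tmul
    (hcomul : ∀ g : G,
      W.comul (MonoidAlgebra.of k G g) =
        (Fintype.card G : k)⁻¹ •
          ∑ h : G, (MonoidAlgebra.of k G (g * h)) ⊗ₜ[k] (MonoidAlgebra.of k G h⁻¹))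
    (a b : MonoidAlgebra k G) :
    W.comul a * ((1 : MonoidAlgebra k G) ⊗ₜ[k] b) = W.comul (a * b) := by
  suffices (LinearMap.mul k _).compl₁₂ W.comul (TensorProduct.mk k _ _ 1) =
      (LinearMap.mul k (MonoidAlgebra k G)).compr₂ W.comul from
    LinearMap.congr_fun₂ this a b
  refine linearMap_ext_of fun g => linearMap_ext_of fun x => ?_
  simp only [LinearMap.compl₁₂_apply, LinearMap.compr₂_apply, LinearMap.mul_apply',
    TensorProduct.mk_apply, ← map_mul, hcomul, smul_mul_assoc, Finset.sum_mul,
    Algebra.TensorProduct.tmul_mul_tmul, mul_one]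
  congr 1
  refine Fintype.sum_equiv (Equiv.mulLeft x⁻¹) _ _ fun u => ?_
  simp [mul_assoc, mul_comm]

theorem comul_cocomm
    (hcomul : ∀ g : G,
      W.comul (MonoidAlgebra.of k G g) =
        (Fintype.card G : k)⁻¹ •
          ∑ h : G, (MonoidAlgebra.of k G (g * h)) ⊗ₜ[k] (MonoidAlgebra.of k G h⁻¹)) :
    W.Cocomm := by
  intro h
  suffices (TensorProduct.comm k _ _).toLinearMap ∘ₗ W.comul = W.comul from
    LinearMap.congr_fun this h
  refine linearMap_ext_of fun g => ?_
  simp only [LinearMap.comp_apply, LinearEquiv.coe_coe, hcomul, map_smul, map_sum,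
    TensorProduct.comm_tmul]
  congr 1
  refine Fintype.sum_equiv ((Equiv.mulLeft g).trans (Equiv.inv G)) _ _ fun u => ?_
  simp

theorem rTensor_comul_comul_of
    (hcomul : ∀ g : G,
      W.comul (MonoidAlgebra.of k G g) =
        (Fintype.card G : k)⁻¹ •
          ∑ h : G, (MonoidAlgebra.of k G (g * h)) ⊗ₜ[k] (MonoidAlgebra.of k G h⁻¹))
    (g : G) :
    LinearMap.rTensor (MonoidAlgebra k G) W.comul (W.comul (MonoidAlgebra.of k G g)) =
      (Fintype.card G : k)⁻¹ • (Fintype.card G : k)⁻¹ • ∑ b : G, ∑ a : G,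
        (MonoidAlgebra.of k G (g * a) ⊗ₜ[k] MonoidAlgebra.of k G b⁻¹) ⊗ₜ[k]
          MonoidAlgebra.of k G (a⁻¹ * b) := by
  simp only [hcomul, map_smul, map_sum, LinearMap.rTensor_tmul, ← TensorProduct.smul_tmul',
    TensorProduct.sum_tmul, ← Finset.smul_sum]
  congr 2
  rw [Finset.sum_comm]
  refine Finset.sum_congr rfl fun b _ => Fintype.sum_equiv (Equiv.mulRight b) _ _ fun a => ?_
  simp [mul_assoc]

theorem rTensor_comul_comul
    (hcomul : ∀ g : G,
      W.comul (MonoidAlgebra.of k G g) =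
        (Fintype.card G : k)⁻¹ •
          ∑ h : G, (MonoidAlgebra.of k G (g * h)) ⊗ₜ[k] (MonoidAlgebra.of k G h⁻¹))
    (h : MonoidAlgebra k G) :
    LinearMap.rTensor (MonoidAlgebra k G) W.comul (W.comul h) =
      LinearMap.lTensor (MonoidAlgebra k G ⊗[k] MonoidAlgebra k G)
        (LinearMap.mul' k (MonoidAlgebra k G))
        (TensorProduct.tensorTensorTensorComm k _ _ _ _ (W.comul h ⊗ₜ[k] W.comul 1)) := by
  suffices LinearMap.rTensor (MonoidAlgebra k G) W.comul ∘ₗ W.comul =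
      LinearMap.lTensor (MonoidAlgebra k G ⊗[k] MonoidAlgebra k G)
          (LinearMap.mul' k (MonoidAlgebra k G)) ∘ₗ
        (TensorProduct.tensorTensorTensorComm k _ _ _ _).toLinearMap ∘ₗ
        (TensorProduct.mk k _ _).flip (W.comul 1) ∘ₗ W.comul from
    LinearMap.congr_fun this h
  refine linearMap_ext_of fun g => ?_
  simp only [LinearMap.comp_apply, LinearMap.flip_apply, TensorProduct.mk_apply,
    LinearEquiv.coe_coe]
  rw [rTensor_comul_comul_of W hcomul, ← map_one (MonoidAlgebra.of k G), hcomul, hcomul]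
  simp only [← TensorProduct.smul_tmul', TensorProduct.tmul_smul, TensorProduct.sum_tmul,
    TensorProduct.tmul_sum, map_smul, map_sum, TensorProduct.tensorTensorTensorComm_tmul,
    LinearMap.lTensor_tmul, LinearMap.mul'_apply, ← map_mul, one_mul]
  rw [← Finset.smul_sum]
  congr 2
  refine Fintype.sum_equiv (Equiv.inv G) _ _ fun b => ?_
  simp

end GroupAlgebra

theorem HG_abelian_weakMatchedPair
    {k : Type*} [Field k] (G : Type*) [CommGroup G] [Fintype G] [DecidableEq G]
    (hcard : (Fintype.card G : k) ≠ 0)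
    (W : WeakBialgebra k (MonoidAlgebra k G))
    (hcomul : ∀ g : G,
      W.comul (MonoidAlgebra.of k G g) =
        (Fintype.card G : k)⁻¹ •
          ∑ h : G, (MonoidAlgebra.of k G (g * h)) ⊗ₜ[k] (MonoidAlgebra.of k G h⁻¹))
    (hcounit : ∀ g : G,
      W.counit (MonoidAlgebra.of k G g) = if g = 1 then (Fintype.card G : k) else 0) :
    IsWeakMatchedPair k W W (LinearMap.mul k (MonoidAlgebra k G)) W.comul ∧
      W.Cocomm ∧ ∀ a b : MonoidAlgebra k G, a * b = b * a := by
  have hmul := mul'_comul W hcard hcomul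
  have hsep := comul_mul_one_tmul W hcomul
  have hcocomm := comul_cocomm W hcomul
  have hεs := εs_apply_of_separable W hsep
  refine ⟨⟨isModuleAlgebra_mul_of_separable W hcocomm hmul hsep, ⟨W.comul_counit, ?_, W.coassoc, ?_⟩,
    mpLHS_eq_mpRHS_of_separable W hmul hsep, ?_, ?_⟩, hcocomm, mul_comm⟩
  · intro h
    exact (rTensor_comul_comul W hcomul h).trans (lTensor_mul'_map_comul_comul W hmul hsep h).symm
  · intro h
    rw [hεs]
  · intro h x
    simp [hεs]
  · have hid : coactCounit k W W.comul = LinearMap.id :=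
      LinearMap.ext (coactCounit_comul W)
    rw [hid, LinearMap.lTensor_id]
    exact rTensor_comul_comul W hcomul 1

end WeakSmash
end
end

section
/- Let (H,A) be a compatible weak matched pair. Then for all h ∈ H: (i) h·1_A = (h₁·1_A)εs(h₂·1_A); (ii) εs(h·1_A) = εs(h₁·1_A)εs(h₂·1_A); (iii) h·1_{A1} ⊗ 1_{A2} = (h·1_A)1_{A1} ⊗ 1_{A2}; (iv) h·1_A = (h·1_{A1})εs(1_{A2}), where Δ(1_A) = 1_{A1}⊗1_{A2}. -/
open TensorProduct

noncomputable section

namespace WeakSmash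

namespace WeakBialgebra

variable {k H : Type*} [Field k] [Ring H] [Algebra k H] (W : WeakBialgebra k H)

theorem εs_apply (x : H) :
    W.εs x = TensorProduct.rid k H
      (LinearMap.lTensor H W.counit (((1 : H) ⊗ₜ[k] x) * W.comul 1)) := rfl

theorem counit_εs_mul (x y : H) : W.counit (W.εs x * y) = W.counit (x * y) := by
  have h := W.counit_weak' x 1 y
  rw [mul_one] at h
  rw [h, εs_apply]
  induction W.comul 1 using TensorProduct.induction_on with
  | zero => simp
  | tmul a b => simp
  | add s t hs ht => simp only [mul_add, map_add, add_mul, hs, ht]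

theorem εs_εs_mul (x y : H) : W.εs (W.εs x * y) = W.εs (x * y) := by
  have key (t : H ⊗[k] H) :
      TensorProduct.rid k H
          (LinearMap.lTensor H W.counit (((1 : H) ⊗ₜ[k] (W.εs x * y)) * t)) =
        TensorProduct.rid k H
          (LinearMap.lTensor H W.counit (((1 : H) ⊗ₜ[k] (x * y)) * t)) := by
    induction t using TensorProduct.induction_on with
    | zero => simp
    | tmul a b => simp [mul_assoc, counit_εs_mul]
    | add s t hs ht => simp only [mul_add, map_add, hs, ht]
  exact key _

/-- Elements in the image of `εs` satisfy `Δ z = 1₁ ⊗ z 1₂`. -/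
theorem comul_εs (x : H) :
    W.comul (W.εs x) = ((1 : H) ⊗ₜ[k] W.εs x) * W.comul 1 := by
  let F : H ⊗[k] (H ⊗[k] H) →ₗ[k] H ⊗[k] H :=
    LinearMap.lTensor H ((TensorProduct.rid k H).toLinearMap ∘ₗ
      LinearMap.lTensor H (W.counit ∘ₗ LinearMap.mulLeft k x))
  have split (u : H) (c : H) : F (TensorProduct.assoc k H H H (W.comul u ⊗ₜ[k] c)) =
      W.counit (x * c) • W.comul u := by
    induction W.comul u using TensorProduct.induction_on with
    | zero => simp
    | tmul a b => simp [F]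
    | add s t hs ht => simp only [TensorProduct.add_tmul, map_add, smul_add, hs, ht]
  have left (t : H ⊗[k] H) :
      W.comul (TensorProduct.rid k H
          (LinearMap.lTensor H W.counit (((1 : H) ⊗ₜ[k] x) * t))) =
        F (TensorProduct.assoc k H H H (LinearMap.rTensor H W.comul t)) := by
    induction t using TensorProduct.induction_on with
    | zero => simp
    | tmul a b => simp [split]
    | add s t hs ht => simp only [mul_add, map_add, hs, ht]
  have right (s t : H ⊗[k] H) :
      F (((1 : H) ⊗ₜ[k] s) * TensorProduct.assoc k H H H (t ⊗ₜ[k] (1 : H))) =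
        ((1 : H) ⊗ₜ[k] TensorProduct.rid k H
          (LinearMap.lTensor H W.counit (((1 : H) ⊗ₜ[k] x) * s))) * t := by
    induction t using TensorProduct.induction_on with
    | zero => simp
    | add t t' ht ht' => simp only [TensorProduct.add_tmul, mul_add, map_add, ht, ht']
    | tmul d e =>
      induction s using TensorProduct.induction_on with
      | zero => simp
      | tmul b c => simp [F]
      | add s s' hs hs' =>
        simp only [TensorProduct.tmul_add, mul_add, add_mul, map_add, hs, hs']
  rw [εs_apply, left, W.coassoc, ← W.comul_one_right, right]

theorem εs_of_comul_eq {z : H} (hz : W.comul z = ((1 : H) ⊗ₜ[k] z) * W.comul 1) :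
    W.εs z = z := by
  rw [εs_apply, ← hz, W.comul_counit]

theorem εs_mul_εs (x y : H) : W.εs (x * W.εs y) = W.εs x * W.εs y := by
  rw [← εs_εs_mul]
  apply εs_of_comul_eq
  calc W.comul (W.εs x * W.εs y)
      = ((1 : H) ⊗ₜ[k] W.εs x) * (W.comul 1 * W.comul (W.εs y)) := by
        rw [W.comul_mul, comul_εs W x, mul_assoc]
    _ = ((1 : H) ⊗ₜ[k] (W.εs x * W.εs y)) * W.comul 1 := by
        rw [← W.comul_mul, one_mul, comul_εs W y, ← mul_assoc,
          Algebra.TensorProduct.tmul_mul_tmul, one_mul]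

/-- The identity `1₁ εs(1₂) = 1`. -/
theorem mul_lTensor_εs_comul_one :
    LinearMap.mul' k H (LinearMap.lTensor H W.εs (W.comul 1)) = 1 := by
  have key (s t : H ⊗[k] H) :
      TensorProduct.rid k H (LinearMap.lTensor H W.counit (s * t)) =
        LinearMap.mul' k H (LinearMap.lTensor H
          ((TensorProduct.rid k H).toLinearMap ∘ₗ LinearMap.lTensor H W.counit ∘ₗ
            LinearMap.mulRight k t ∘ₗ TensorProduct.mk k H H 1) s) := by
    induction s using TensorProduct.induction_on with
    | zero => simp
    | add s s' hs hs' => simp only [add_mul, map_add, hs, hs']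
    | tmul a b =>
      induction t using TensorProduct.induction_on with
      | zero => simp
      | tmul c d => simp
      | add t t' ht ht' =>
        simp only [LinearMap.lTensor_tmul, LinearMap.mul'_apply, LinearMap.comp_apply,
          LinearMap.mulRight_apply, mul_add, map_add] at ht ht' ⊢
        rw [ht, ht']
  have h := key (W.comul 1) (W.comul 1)
  rw [← W.comul_mul, one_mul, W.comul_counit] at h
  exact h.symm

end WeakBialgebra

namespace IsCompatiblePair

variable {k H A : Type*} [Field k] [Ring H] [Algebra k H] [Ring A] [Algebra k A]
  {WH : WeakBialgebra k H} {WA : WeakBialgebra k A}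
  {act : H →ₗ[k] A →ₗ[k] A} {coact : H →ₗ[k] H ⊗[k] A}

theorem act_one_eq_mul_εs (hCP : IsCompatiblePair k WH WA act coact) (h : H) :
    act h 1 = LinearMap.mul' k A
      ((TensorProduct.map (act.flip 1) (WA.εs ∘ₗ act.flip 1)) (WH.comul h)) := by
  rw [hCP.compat1 h]
  induction WH.comul h using TensorProduct.induction_on with
  | zero => simp
  | add s t hs ht => simp only [TensorProduct.add_tmul, map_add, hs, ht]
  | tmul g l =>
    have left (t : A ⊗[k] A) :
        TensorProduct.map (TensorProduct.lift act) (WA.counit ∘ₗ TensorProduct.lift act)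
            (TensorProduct.tensorTensorTensorComm k H H A A ((g ⊗ₜ[k] l) ⊗ₜ[k] t)) =
          LinearMap.lTensor A WA.counit (TensorProduct.map (act g) (act l) t) := by
      induction t using TensorProduct.induction_on with
      | zero => simp
      | tmul a b => simp
      | add s t hs ht => simp only [TensorProduct.tmul_add, map_add, hs, ht]
    have right (a b : A) (t : A ⊗[k] A) :
        TensorProduct.rid k A (LinearMap.lTensor A WA.counit
            (TensorProduct.map (LinearMap.mulLeft k a) (LinearMap.mulLeft k b) t)) =
          a * TensorProduct.rid k A
            (LinearMap.lTensor A WA.counit (((1 : A) ⊗ₜ[k] b) * t)) := by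
      induction t using TensorProduct.induction_on with
      | zero => simp
      | tmul c d => simp
      | add s t hs ht => simp only [mul_add, map_add, hs, ht]
    rw [left, hCP.compat2, right]
    rfl

theorem εs_act_one (hCP : IsCompatiblePair k WH WA act coact) (h : H) :
    WA.εs (act h 1) = LinearMap.mul' k A
      ((TensorProduct.map (WA.εs ∘ₗ act.flip 1) (WA.εs ∘ₗ act.flip 1)) (WH.comul h)) := by
  rw [hCP.act_one_eq_mul_εs h]
  induction WH.comul h using TensorProduct.induction_on with
  | zero => simp
  | tmul a b => simp [WA.εs_mul_εs]
  | add s t hs ht => simp only [map_add, hs, ht]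

theorem rTensor_act_comul_one (hCP : IsCompatiblePair k WH WA act coact) (h : H) :
    LinearMap.rTensor A (act h) (WA.comul 1) =
      LinearMap.rTensor A (LinearMap.mulLeft k (act h 1)) (WA.comul 1) := by
  have act_one : act 1 = LinearMap.id := LinearMap.ext hCP.pair.moduleAlgebra.one_act
  simpa [act_one, LinearMap.rTensor] using hCP.compat2 h 1

theorem act_one_eq_mul_εs_comul_one (hCP : IsCompatiblePair k WH WA act coact) (h : H) :
    act h 1 = LinearMap.mul' k A ((TensorProduct.map (act h) WA.εs) (WA.comul 1)) := by
  have factor (a : A) (t : A ⊗[k] A) :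
      LinearMap.mul' k A
          (LinearMap.lTensor A WA.εs (LinearMap.rTensor A (LinearMap.mulLeft k a) t)) =
        a * LinearMap.mul' k A (LinearMap.lTensor A WA.εs t) := by
    induction t using TensorProduct.induction_on with
    | zero => simp
    | tmul c d => simp [mul_assoc]
    | add s t hs ht => simp only [mul_add, map_add, hs, ht]
  rw [← LinearMap.lTensor_comp_rTensor, LinearMap.comp_apply, hCP.rTensor_act_comul_one,
    factor, WA.mul_lTensor_εs_comul_one, mul_one]

end IsCompatiblePair

theorem compatiblePair_basic
    {k H A : Type*} [Field k] [Ring H] [Algebra k H] [Ring A] [Algebra k A]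
    (WH : WeakBialgebra k H) (WA : WeakBialgebra k A)
    (act : H →ₗ[k] A →ₗ[k] A) (coact : H →ₗ[k] H ⊗[k] A)
    (hCP : IsCompatiblePair k WH WA act coact) :
    (∀ h : H,
        act h 1 =
          LinearMap.mul' k A
            ((TensorProduct.map (act.flip 1) (WA.εs ∘ₗ act.flip 1)) (WH.comul h))) ∧
    (∀ h : H,
        WA.εs (act h 1) =
          LinearMap.mul' k A
            ((TensorProduct.map (WA.εs ∘ₗ act.flip 1) (WA.εs ∘ₗ act.flip 1))
              (WH.comul h))) ∧
    (∀ h : H,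
        (LinearMap.rTensor A (act h)) (WA.comul 1) =
          (LinearMap.rTensor A (LinearMap.mulLeft k (act h 1))) (WA.comul 1)) ∧
    (∀ h : H,
        act h 1 =
          LinearMap.mul' k A ((TensorProduct.map (act h) WA.εs) (WA.comul 1))) := by
  exact ⟨hCP.act_one_eq_mul_εs, hCP.εs_act_one, hCP.rTensor_act_comul_one,
    hCP.act_one_eq_mul_εs_comul_one⟩

end WeakSmash
end
end
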